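/- arXiv:2503.23070 — 4 statements merged into one kernel-verified Lean document; each statement's English description precedes it below -/
import Mathlib

section
/- For all α = (α_1,…,α_d) ∈ (0,1)^d, t ∈ ℝ_+^d and every real u with |u| ≤ 1, the distribution p^α of the multiparameter GCP time-changed by a multiparameter stable subordinator has probability generating function Σ_{n=0}^∞ p^α(n,t) u^n = exp(−Σ_{i=1}^d t_i (Σ_{j=1}^k λ_{ji}(1 − u^j))^{α_i}). -/
open scoped BigOperators

/-- The distribution `p^α(n,t)` of the multiparameter GCP time-changed by a multiparameter
stable subordinator with stability indices `α_1,…,α_d`: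
`p^α(n,t) = Σ_{(n_1,…,n_d) ∈ Θ(n,d)} ∏_i Σ_{(n_{1i},…,n_{ki}) ∈ Ω(k,n_i)}
  (∏_j (−λ_{ji}/μ_i)^{n_{ji}}/n_{ji}!) Σ_r (−μ_i^{α_i} t_i)^r Γ(α_i r + 1)
  / (r! Γ(α_i r + 1 − Σ_j n_{ji}))`,
where `μ_i = λ_{1i} + ⋯ + λ_{ki}`. Note that `Real.Gamma` vanishes at nonpositive
integers, so `1/Γ` is `0` there, as required. -/
noncomputable def pAlpha (d k : ℕ) (lam : Fin k → Fin d → ℝ) (alpha : Fin d → ℝ)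
    (n : ℕ) (t : Fin d → ℝ) : ℝ :=
  ∑' m : Fin d → ℕ,
    if (∑ i, m i) = n then
      ∏ i, ∑' x : Fin k → ℕ,
        if (∑ j, (j.1 + 1) * x j) = m i then
          (∏ j, (-(lam j i) / (∑ j', lam j' i)) ^ (x j) / (Nat.factorial (x j))) *
            ∑' r : ℕ, (-((∑ j', lam j' i) ^ alpha i) * t i) ^ r *
              Real.Gamma (alpha i * r + 1) /
              ((Nat.factorial r) * Real.Gamma (alpha i * r + 1 - ∑ j, (x j : ℝ)))
        else 0
    else 0

theorem Real.succ_mul_choose (a : ℝ) (n : ℕ) :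
    (n + 1) * Ring.choose a (n + 1) = (a - n) * Ring.choose a n := by
  have h1 := Ring.descPochhammer_eq_factorial_smul_choose a (n + 1)
  have h0 := Ring.descPochhammer_eq_factorial_smul_choose a n
  rw [descPochhammer_succ_right, Polynomial.smeval_mul, h0] at h1
  simp only [Polynomial.smeval_sub, Polynomial.smeval_X, Polynomial.smeval_natCast, nsmul_eq_mul,
    Nat.factorial_succ, Nat.cast_mul, pow_zero, pow_one, mul_one, Nat.cast_add, Nat.cast_one] at h1
  have hn : (n.factorial : ℝ) ≠ 0 := by positivity
  apply mul_left_cancel₀ hn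
  linear_combination -h1

theorem Real.succ_mul_choose_add_one (a : ℝ) (n : ℕ) :
    (n + 1) * Ring.choose (a + 1) (n + 1) = (a + 1) * Ring.choose a n := by
  induction n with
  | zero => simp
  | succ n ih =>
    have h1 := Real.succ_mul_choose (a + 1) (n + 1)
    have h0 := Real.succ_mul_choose a n
    push_cast at h1 ⊢
    refine mul_left_cancel₀ (by positivity : (n : ℝ) + 1 ≠ 0) ?_
    linear_combination (n + 1 : ℝ) * h1 + (a - n) * ih - (a + 1) * h0

theorem Real.Gamma_div_Gamma_sub_natCast {a : ℝ} (ha : 0 ≤ a) (n : ℕ) :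
    Real.Gamma (a + 1) / Real.Gamma (a + 1 - n) = n.factorial * Ring.choose a n := by
  induction n with
  | zero => simp [div_self (Real.Gamma_pos_of_pos (by linarith : 0 < a + 1)).ne']
  | succ n ih =>
    have hs : (((n + 1).factorial : ℕ) : ℝ) * Ring.choose a (n + 1)
        = (a - n) * (n.factorial * Ring.choose a n) := by
      rw [Nat.factorial_succ]
      push_cast
      linear_combination (n.factorial : ℝ) * Real.succ_mul_choose a n
    rw [hs, ← ih, show a + 1 - ((n + 1 : ℕ) : ℝ) = a - n by push_cast; ring]
    rcases eq_or_ne (a - n) 0 with h | h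
    · simp [h]
    · rw [show a + 1 - (n : ℝ) = a - n + 1 by ring, Real.Gamma_add_one h]
      field_simp

theorem Real.choose_neg_mul_neg_one_pow_nonneg {a : ℝ} (ha : 0 ≤ a) (n : ℕ) :
    0 ≤ (-1) ^ n * Ring.choose (-a) n := by
  induction n with
  | zero => simp
  | succ n ih =>
    have h := Real.succ_mul_choose (-a) n
    have : 0 ≤ (n + 1 : ℝ) * ((-1) ^ (n + 1) * Ring.choose (-a) (n + 1)) := by
      have : (n + 1 : ℝ) * ((-1) ^ (n + 1) * Ring.choose (-a) (n + 1))
          = (a + n) * ((-1) ^ n * Ring.choose (-a) n) := by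
        linear_combination (-1) ^ (n + 1) * h
      rw [this]
      positivity
    exact nonneg_of_mul_nonneg_right this (by positivity)

theorem Real.abs_choose_le {a : ℝ} (ha : 0 ≤ a) (n : ℕ) :
    |Ring.choose a n| ≤ (-1) ^ n * Ring.choose (-a) n := by
  suffices |Ring.choose a n| ≤ |Ring.choose (-a) n| by
    rwa [← abs_of_nonneg (Real.choose_neg_mul_neg_one_pow_nonneg ha n), abs_mul, abs_neg_one_pow,
      one_mul]
  induction n with
  | zero => simp
  | succ n ih =>
    have hn : (0 : ℝ) < n + 1 := by positivity
    have h1 := congrArg abs (Real.succ_mul_choose a n)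
    have h2 := congrArg abs (Real.succ_mul_choose (-a) n)
    rw [abs_mul, abs_mul, abs_of_pos hn] at h1 h2
    refine le_of_mul_le_mul_left ?_ hn
    rw [h1, h2]
    gcongr ?_ * ?_
    rw [← sq_le_sq]
    nlinarith [mul_nonneg ha n.cast_nonneg]

theorem Real.hasSum_choose_mul_pow (a : ℝ) {w : ℝ} (hw : |w| < 1) :
    HasSum (fun n : ℕ => Ring.choose a n * w ^ n) ((1 + w) ^ a) := by
  have h := (Real.one_add_rpow_hasFPowerSeriesOnBall_zero (a := a)).hasSum (y := w)
    (by simpa [enorm_eq_nnnorm, ← NNReal.coe_lt_one] using hw)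
  simpa [binomialSeries, FormalMultilinearSeries.coeff_ofScalars, mul_comm] using h

/-- The Taylor coefficients at `1` of `z ↦ exp (c * z ^ a)`. -/
noncomputable def stretchedExpCoeff (c a : ℝ) (n : ℕ) : ℝ :=
  ∑' r : ℕ, c ^ r / r.factorial * Ring.choose (a * r) n

theorem summable_stretchedExp (c : ℝ) {a w : ℝ} (ha : 0 ≤ a) (hw : |w| < 1) :
    Summable fun p : ℕ × ℕ =>
      c ^ p.1 / p.1.factorial * (Ring.choose (a * p.1) p.2 * w ^ p.2) := by
  have hs (r : ℕ) : HasSum (fun n : ℕ => |c| ^ r / r.factorial *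
      ((-1) ^ n * Ring.choose (-(a * r)) n * |w| ^ n))
      ((|c| * (1 - |w|) ^ (-a)) ^ r / r.factorial) := by
    have h := (Real.hasSum_choose_mul_pow (-(a * r)) (w := -|w|) (by simpa)).mul_left
      (|c| ^ r / r.factorial)
    convert! h using 1
    · ext n
      rw [neg_pow |w|]
      ring
    · rw [mul_pow, ← Real.rpow_mul_natCast (by linarith), ← sub_eq_add_neg]
      ring_nf
  have hnn (p : ℕ × ℕ) : 0 ≤ |c| ^ p.1 / p.1.factorial *
      ((-1) ^ p.2 * Ring.choose (-(a * p.1)) p.2 * |w| ^ p.2) := by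
    have := Real.choose_neg_mul_neg_one_pow_nonneg (a := a * p.1) (by positivity) p.2
    positivity
  refine Summable.of_norm_bounded (g := fun p : ℕ × ℕ => |c| ^ p.1 / p.1.factorial *
      ((-1) ^ p.2 * Ring.choose (-(a * p.1)) p.2 * |w| ^ p.2)) ?_ fun p => ?_
  · rw [summable_prod_of_nonneg hnn]
    refine ⟨fun r => (hs r).summable, ?_⟩
    simp only [fun r => (hs r).tsum_eq]
    exact Real.summable_pow_div_factorial _
  · rw [Real.norm_eq_abs, abs_mul, abs_mul, abs_div, abs_pow, abs_pow, Nat.abs_cast]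
    gcongr
    exact Real.abs_choose_le (by positivity) _

theorem summable_stretchedExpCoeff (c : ℝ) {a : ℝ} (ha : 0 ≤ a) (n : ℕ) :
    Summable fun r : ℕ => c ^ r / r.factorial * Ring.choose (a * r) n := by
  have h := ((summable_stretchedExp c (w := 1 / 2) ha (by norm_num [abs_of_pos])).prod_symm.prod_factor
    n).mul_right (2 ^ n)
  refine h.congr fun r => ?_
  simp only [Prod.swap_prod_mk, mul_assoc, ← mul_pow]
  norm_num

theorem hasSum_stretchedExpCoeff_mul_pow (c : ℝ) {a w : ℝ} (ha : 0 ≤ a) (hw : |w| < 1) :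
    HasSum (fun n : ℕ => stretchedExpCoeff c a n * w ^ n) (Real.exp (c * (1 + w) ^ a)) := by
  have h := summable_stretchedExp c ha hw
  have hr (r : ℕ) : HasSum (fun n : ℕ => c ^ r / r.factorial * (Ring.choose (a * r) n * w ^ n))
      ((c * (1 + w) ^ a) ^ r / r.factorial) := by
    have := (Real.hasSum_choose_mul_pow (a * r) hw).mul_left (c ^ r / r.factorial)
    rwa [Real.rpow_mul_natCast (by linarith [neg_abs_le w]), div_mul_eq_mul_div, ← mul_pow] at this
  have hexp : HasSum (fun r : ℕ => (c * (1 + w) ^ a) ^ r / r.factorial)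
      (Real.exp (c * (1 + w) ^ a)) := by
    rw [Real.exp_eq_exp_ℝ]
    exact NormedSpace.expSeries_div_hasSum_exp _
  have htot : ∑' p : ℕ × ℕ, c ^ p.1 / p.1.factorial * (Ring.choose (a * p.1) p.2 * w ^ p.2)
      = Real.exp (c * (1 + w) ^ a) :=
    (h.hasSum.prod_fiberwise hr).unique hexp
  refine HasSum.prod_fiberwise ((Equiv.prodComm ℕ ℕ).hasSum_iff.2 (htot ▸ h.hasSum)) fun n => ?_
  simpa [stretchedExpCoeff, mul_assoc] using
    (summable_stretchedExpCoeff c ha n).hasSum.mul_right (w ^ n)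

theorem succ_mul_stretchedExpCoeff (c : ℝ) {a : ℝ} (ha : 0 ≤ a) (n : ℕ) :
    (n + 1) * stretchedExpCoeff c a (n + 1) = c * a * ∑ p ∈ Finset.HasAntidiagonal.antidiagonal n,
      stretchedExpCoeff c a p.1 * Ring.choose (a - 1) p.2 := by
  have hterm (r : ℕ) : (n + 1) * (c ^ (r + 1) / (r + 1).factorial *
      Ring.choose (a * (r + 1 : ℕ)) (n + 1)) = c * a * ∑ p ∈ Finset.HasAntidiagonal.antidiagonal n,
        c ^ r / r.factorial * Ring.choose (a * r) p.1 * Ring.choose (a - 1) p.2 := by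
    have hV := Ring.add_choose_eq n (Commute.all (a * r) (a - 1))
    have hr : (a * (r + 1 : ℕ) : ℝ) = a * r + (a - 1) + 1 := by push_cast; ring
    have hfac : (r.factorial : ℝ) ≠ 0 := by positivity
    have hr1 : (r + 1 : ℝ) ≠ 0 := by positivity
    simp only [mul_assoc, ← Finset.mul_sum]
    rw [← hV, mul_left_comm, hr, Real.succ_mul_choose_add_one, ← hr, Nat.factorial_succ]
    push_cast
    field_simp
    ring
  have hF := (summable_stretchedExpCoeff c ha (n + 1)).hasSum.mul_left ((n : ℝ) + 1)
  rw [← hasSum_nat_add_iff' 1] at hF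
  have hG : HasSum (fun r : ℕ => c * a * ∑ p ∈ Finset.HasAntidiagonal.antidiagonal n,
      c ^ r / r.factorial * Ring.choose (a * r) p.1 * Ring.choose (a - 1) p.2)
      (c * a * ∑ p ∈ Finset.HasAntidiagonal.antidiagonal n,
        stretchedExpCoeff c a p.1 * Ring.choose (a - 1) p.2) :=
    (hasSum_sum fun p _ =>
      (summable_stretchedExpCoeff c ha p.1).hasSum.mul_right (Ring.choose (a - 1) p.2)).mul_left _
  simp only [hterm] at hF
  rw [← hF.unique hG]
  simp [stretchedExpCoeff, Ring.choose_zero_succ]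

theorem neg_one_pow_mul_stretchedExpCoeff_nonneg {c a : ℝ} (hc : c ≤ 0) (ha : 0 ≤ a) (ha1 : a ≤ 1)
    (n : ℕ) : 0 ≤ (-1) ^ n * stretchedExpCoeff c a n := by
  induction n using Nat.strong_induction_on with
  | _ n ih =>
    cases n with
    | zero =>
      have : stretchedExpCoeff c a 0 = Real.exp c := by
        simp [stretchedExpCoeff, Real.exp_eq_exp_ℝ, NormedSpace.exp_eq_tsum_div]
      simpa [this] using (Real.exp_pos c).le
    | succ n =>
      have h : (n + 1) * ((-1) ^ (n + 1) * stretchedExpCoeff c a (n + 1)) =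
          (-c) * a * ∑ p ∈ Finset.HasAntidiagonal.antidiagonal n,
            ((-1) ^ p.1 * stretchedExpCoeff c a p.1) *
            ((-1) ^ p.2 * Ring.choose (-(1 - a)) p.2) := by
        have hsum : ∑ p ∈ Finset.HasAntidiagonal.antidiagonal n,
            ((-1) ^ p.1 * stretchedExpCoeff c a p.1) *
            ((-1) ^ p.2 * Ring.choose (-(1 - a)) p.2) = (-1) ^ n *
              ∑ p ∈ Finset.HasAntidiagonal.antidiagonal n,
              stretchedExpCoeff c a p.1 * Ring.choose (a - 1) p.2 := by
          rw [Finset.mul_sum]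
          refine Finset.sum_congr rfl fun p hp => ?_
          rw [← Finset.HasAntidiagonal.mem_antidiagonal.1 hp, pow_add, neg_sub]
          ring
        rw [hsum]
        linear_combination (-1) ^ (n + 1) * succ_mul_stretchedExpCoeff c ha n
      refine nonneg_of_mul_nonneg_right (a := (n : ℝ) + 1) ?_ (by positivity)
      rw [h]
      refine mul_nonneg (mul_nonneg (by linarith) ha) (Finset.sum_nonneg fun p hp => ?_)
      exact mul_nonneg (ih _ (by have := Finset.HasAntidiagonal.mem_antidiagonal.1 hp; omega))
        (Real.choose_neg_mul_neg_one_pow_nonneg (by linarith) _)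

theorem hasSum_mul_pow_of_nonneg_of_abs_le_one {b : ℕ → ℝ} {f : ℝ → ℝ} (hb : ∀ n, 0 ≤ b n)
    (hf : ContinuousOn f (Set.Icc (-1) 1))
    (h : ∀ w, |w| < 1 → HasSum (fun n => b n * w ^ n) (f w)) {w : ℝ} (hw : |w| ≤ 1) :
    HasSum (fun n => b n * w ^ n) (f w) := by
  have hsum : Summable b := by
    refine summable_of_sum_range_le (c := f 1) hb fun n => ?_
    have h1 : Filter.Tendsto (fun w : ℝ => ∑ i ∈ Finset.range n, b i * w ^ i)
        (nhdsWithin 1 (Set.Ioo 0 1)) (nhds (∑ i ∈ Finset.range n, b i)) := by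
      have : Continuous fun w : ℝ => ∑ i ∈ Finset.range n, b i * w ^ i := by fun_prop
      simpa using (this.tendsto 1).mono_left nhdsWithin_le_nhds
    have h2 : Filter.Tendsto f (nhdsWithin 1 (Set.Ioo 0 1)) (nhds (f 1)) :=
      (hf 1 (by simp)).mono fun x hx => ⟨by linarith [hx.1], hx.2.le⟩
    have : (nhdsWithin (1 : ℝ) (Set.Ioo 0 1)).NeBot :=
      mem_closure_iff_nhdsWithin_neBot.1 (by rw [closure_Ioo zero_ne_one]; simp)
    refine le_of_tendsto_of_tendsto h1 h2 ?_
    filter_upwards [self_mem_nhdsWithin] with w hw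
    exact sum_le_hasSum _ (fun i _ => mul_nonneg (hb i) (pow_nonneg hw.1.le i))
      (h w (by rw [abs_of_pos hw.1]; exact hw.2))
  have hbound (n : ℕ) (w : ℝ) (hw : w ∈ Set.Icc (-1 : ℝ) 1) : ‖b n * w ^ n‖ ≤ b n := by
    rw [norm_mul, norm_pow, Real.norm_of_nonneg (hb n)]
    exact mul_le_of_le_one_right (hb n) (pow_le_one₀ (norm_nonneg _) (abs_le.2 hw))
  have hcont : ContinuousOn (fun w => ∑' n, b n * w ^ n) (Set.Icc (-1) 1) :=
    continuousOn_tsum (fun n => by fun_prop) hsum hbound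
  have heq : Set.EqOn (fun w => ∑' n, b n * w ^ n) f (Set.Icc (-1) 1) := by
    refine Set.EqOn.of_subset_closure (s := Set.Ioo (-1) 1) (fun w hw => ?_) hcont hf
      Set.Ioo_subset_Icc_self (by rw [closure_Ioo (by norm_num)])
    exact (h w (abs_lt.2 hw)).tsum_eq
  have hmem := abs_le.1 hw
  have := (Summable.of_norm_bounded hsum fun n => hbound n w hmem).hasSum
  rwa [show ∑' n, b n * w ^ n = f w from heq hmem] at this

theorem HasSum.tsum_ite_fiberwise {β γ : Type*} [DecidableEq γ] {f : β → ℝ} {s : ℝ}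
    (h : HasSum f s) (g : β → γ) : HasSum (fun c => ∑' b, if g b = c then f b else 0) s := by
  convert! h.tsum_fiberwise g using 2 with c
  rw [tsum_subtype (g ⁻¹' {c}) f]
  exact tsum_congr fun b => by classical rw [Set.indicator_apply]; congr

theorem hasSum_multinomial_mul_prod_pow {ι : Type*} [Fintype ι] [DecidableEq ι] {b : ℕ → ℝ}
    {y : ι → ℝ} {s : ℝ}
    (hs : HasSum (fun n => b n * (∑ i, y i) ^ n) s)
    (habs : Summable fun n => |b n| * (∑ i, |y i|) ^ n) :
    HasSum (fun x : ι → ℕ => b (∑ i, x i) * (Nat.multinomial Finset.univ x * ∏ i, y i ^ x i))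
      s := by
  have hfib (b : ℕ → ℝ) (y : ι → ℝ) (n : ℕ) :
      HasSum (fun x : (fun x : ι → ℕ => ∑ i, x i) ⁻¹' {n} =>
        b (∑ i, x.1 i) * (Nat.multinomial Finset.univ x.1 * ∏ i, y i ^ x.1 i))
        (b n * (∑ i, y i) ^ n) := by
    rw [Finset.sum_pow_eq_sum_piAntidiag, Finset.mul_sum]
    refine (hasSum_subtype_iff_indicator (f := fun x : ι → ℕ =>
        b (∑ i, x i) * (Nat.multinomial Finset.univ x * ∏ i, y i ^ x i))).2 ?_
    have hsum := hasSum_sum_of_ne_finset_zero (L := .unconditional _)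
      (f := ((fun x : ι → ℕ => ∑ i, x i) ⁻¹' {n}).indicator
      fun x => b (∑ i, x i) * (Nat.multinomial Finset.univ x * ∏ i, y i ^ x i))
      (s := Finset.piAntidiag Finset.univ n) fun x hx => by
        rw [Set.indicator_of_notMem]
        simpa using hx
    convert hsum using 1
    refine Finset.sum_congr rfl fun x hx => ?_
    have hx : ∑ i, x i = n := by simpa using hx
    rw [Set.indicator_of_mem (by simpa using hx), hx]
  have hsummable : Summable fun x : ι → ℕ =>
      b (∑ i, x i) * (Nat.multinomial Finset.univ x * ∏ i, y i ^ x i) := by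
    refine Summable.of_abs ?_
    have hF (x : ι → ℕ) : |b (∑ i, x i) * (Nat.multinomial Finset.univ x * ∏ i, y i ^ x i)|
        = |b (∑ i, x i)| * (Nat.multinomial Finset.univ x * ∏ i, |y i| ^ x i) := by
      simp [abs_mul, Finset.abs_prod, abs_pow]
    simp only [hF]
    rw [← (Equiv.sigmaFiberEquiv fun x : ι → ℕ => ∑ i, x i).summable_iff,
      summable_sigma_of_nonneg fun _ => by dsimp; positivity]
    refine ⟨fun n => (hfib (fun n => |b n|) (fun i => |y i|) n).summable, ?_⟩
    refine habs.congr fun n => ?_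
    exact (hfib (fun n => |b n|) (fun i => |y i|) n).tsum_eq.symm
  have := hsummable.hasSum.tsum_fiberwise fun x : ι → ℕ => ∑ i, x i
  simp only [fun n => (hfib b y n).tsum_eq] at this
  exact hs.unique this ▸ hsummable.hasSum

theorem hasSum_pi_prod {κ : Type*} {d : ℕ} {f : Fin d → κ → ℝ} {s : Fin d → ℝ}
    (h : ∀ i, HasSum (f i) (s i)) :
    HasSum (fun m : Fin d → κ => ∏ i, f i (m i)) (∏ i, s i) := by
  induction d with
  | zero => simp [hasSum_unique]
  | succ d ih =>
    have hg : HasSum (fun m : Fin d → κ => ∏ i : Fin d, f i.succ (m i)) (∏ i : Fin d, s i.succ) :=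
      ih fun i => h i.succ
    have hfg : Summable fun p : κ × (Fin d → κ) => f 0 p.1 * ∏ i, f i.succ (p.2 i) :=
      summable_mul_of_summable_norm (f := f 0)
        (g := fun m : Fin d → κ => ∏ i : Fin d, f i.succ (m i))
        (summable_norm_iff.2 (h 0).summable) (summable_norm_iff.2 hg.summable)
    rw [← (Fin.consEquiv fun _ : Fin (d + 1) => κ).hasSum_iff, Fin.prod_univ_succ]
    convert! (h 0).mul hg hfg using 2 with p
    simp [Fin.consEquiv, Fin.prod_univ_succ]

theorem tsum_Gamma_eq_factorial_mul_stretchedExpCoeff (c : ℝ) {a : ℝ} (ha : 0 ≤ a) (n : ℕ) :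
    ∑' r : ℕ, c ^ r * Real.Gamma (a * r + 1) / (r.factorial * Real.Gamma (a * r + 1 - n))
      = n.factorial * stretchedExpCoeff c a n := by
  rw [stretchedExpCoeff, ← tsum_mul_left]
  refine tsum_congr fun r => ?_
  rw [mul_div_mul_comm, Real.Gamma_div_Gamma_sub_natCast (by positivity)]
  ring

theorem prod_div_factorial_mul_factorial_sum {ι : Type*} [Fintype ι] (q : ι → ℝ) (x : ι → ℕ) :
    (∏ i, q i ^ x i / (x i).factorial) * (∑ i, x i).factorial
      = Nat.multinomial Finset.univ x * ∏ i, q i ^ x i := by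
  have h : (∏ i, ((x i).factorial : ℝ)) ≠ 0 := Finset.prod_ne_zero_iff.2 fun i _ => by positivity
  rw [Finset.prod_div_distrib, ← Nat.multinomial_spec]
  push_cast
  field_simp

theorem hasSum_stretchedExpCoeff_mul_pow_of_abs_le_one {c a w : ℝ} (hc : c ≤ 0) (ha : 0 < a)
    (ha1 : a ≤ 1) (hw : |w| ≤ 1) :
    HasSum (fun n : ℕ => (-1) ^ n * stretchedExpCoeff c a n * w ^ n)
      (Real.exp (c * (1 - w) ^ a)) := by
  refine hasSum_mul_pow_of_nonneg_of_abs_le_one (f := fun w => Real.exp (c * (1 - w) ^ a))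
    (neg_one_pow_mul_stretchedExpCoeff_nonneg hc ha.le ha1) ?_ (fun w hw => ?_) hw
  · have : Continuous fun w : ℝ => (1 - w) ^ a :=
      (Real.continuous_rpow_const ha.le).comp (by fun_prop)
    exact (Real.continuous_exp.comp (continuous_const.mul this)).continuousOn
  · convert! hasSum_stretchedExpCoeff_mul_pow c (w := -w) ha.le (by simpa) using 2 with n
    rw [neg_pow w]
    ring

theorem hasSum_pgf_factor {k : ℕ} (hk : 0 < k) {l : Fin k → ℝ} (hl : ∀ j, 0 < l j) {a t u : ℝ}
    (ha : 0 < a) (ha1 : a ≤ 1) (ht : 0 ≤ t) (hu : |u| ≤ 1) :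
    HasSum (fun m : ℕ => (∑' x : Fin k → ℕ,
      if (∑ j, (j.1 + 1) * x j) = m then
        (∏ j, (-(l j) / (∑ j', l j')) ^ (x j) / (Nat.factorial (x j))) *
          ∑' r : ℕ, (-((∑ j', l j') ^ a) * t) ^ r * Real.Gamma (a * r + 1) /
            ((Nat.factorial r) * Real.Gamma (a * r + 1 - ∑ j, (x j : ℝ)))
      else 0) * u ^ m)
      (Real.exp (-(t * (∑ j : Fin k, l j * (1 - u ^ (j.1 + 1))) ^ a))) := by
  set μ := ∑ j, l j with hμ_def
  have hμ : 0 < μ := Finset.sum_pos (fun j _ => hl j) ⟨⟨0, hk⟩, Finset.mem_univ _⟩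
  set c := -(μ ^ a) * t with hc_def
  have hc : c ≤ 0 := mul_nonpos_of_nonpos_of_nonneg (by simpa using Real.rpow_nonneg hμ.le a) ht
  set y : Fin k → ℝ := fun j => -(l j) / μ * u ^ (j.1 + 1) with hy_def
  have hy_abs : ∑ j, |y j| ≤ 1 := by
    calc ∑ j, |y j| ≤ ∑ j, l j / μ := Finset.sum_le_sum fun j _ => by
          rw [hy_def, abs_mul, abs_div, abs_neg, abs_of_pos (hl j), abs_of_pos hμ, abs_pow]
          exact mul_le_of_le_one_right (div_pos (hl j) hμ).le (pow_le_one₀ (abs_nonneg _) hu)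
      _ = 1 := by rw [← Finset.sum_div, div_self hμ.ne']
  have hsum : HasSum (fun n => stretchedExpCoeff c a n * (∑ j, y j) ^ n)
      (Real.exp (c * (1 - -∑ j, y j) ^ a)) := by
    convert! hasSum_stretchedExpCoeff_mul_pow_of_abs_le_one hc ha ha1 (w := -∑ j, y j)
      (by rw [abs_neg]; exact (Finset.abs_sum_le_sum_abs _ _).trans hy_abs) using 2 with n
    rw [mul_right_comm, ← mul_pow, neg_one_mul, neg_neg, mul_comm]
  have habs : Summable fun n => |stretchedExpCoeff c a n| * (∑ j, |y j|) ^ n := by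
    convert (hasSum_stretchedExpCoeff_mul_pow_of_abs_le_one hc ha ha1 (w := ∑ j, |y j|)
      (by rwa [abs_of_nonneg (Finset.sum_nonneg fun j _ => abs_nonneg _)])).summable using 3 with n
    rw [← abs_of_nonneg (neg_one_pow_mul_stretchedExpCoeff_nonneg hc ha.le ha1 n), abs_mul,
      abs_neg_one_pow, one_mul]
  have h := (hasSum_multinomial_mul_prod_pow hsum habs).tsum_ite_fiberwise
    fun x : Fin k → ℕ => ∑ j, (j.1 + 1) * x j
  convert! h using 1
  · ext m
    rw [← tsum_mul_right]
    refine tsum_congr fun x => ?_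
    split_ifs with hx
    · have hprod : ∏ j, y j ^ x j = (∏ j, (-(l j) / μ) ^ x j) * u ^ m := by
        simp only [hy_def, mul_pow, Finset.prod_mul_distrib, ← pow_mul, Finset.prod_pow_eq_pow_sum,
          hx]
      rw [← Nat.cast_sum, tsum_Gamma_eq_factorial_mul_stretchedExpCoeff c ha.le, hprod, ← mul_assoc,
        prod_div_factorial_mul_factorial_sum]
      ring
    · simp
  · have hbase : ∑ j : Fin k, l j * (1 - u ^ (j.1 + 1)) = μ * (1 - -∑ j, y j) := by
      rw [sub_neg_eq_add, mul_add, Finset.mul_sum, mul_one,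
        ← Finset.sum_add_distrib]
      refine Finset.sum_congr rfl fun j _ => ?_
      simp only [hy_def]
      field_simp
      ring
    have hnn : 0 ≤ 1 - -∑ j, y j := by
      linarith [neg_abs_le (∑ j, y j), Finset.abs_sum_le_sum_abs y Finset.univ]
    rw [hbase, Real.mul_rpow hμ.le hnn, hc_def]
    ring_nf

/-- For all `α ∈ (0,1)^d`, `t ∈ ℝ_+^d` and every real `u` with `|u| ≤ 1`, the distribution
`p^α` of the multiparameter GCP time-changed by a multiparameter stable subordinator has
probability generating function
`Σ_{n=0}^∞ p^α(n,t) u^n = exp(−Σ_{i=1}^d t_i (Σ_{j=1}^k λ_{ji}(1 − u^j))^{α_i})`. -/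
theorem pAlpha_pgf (d k : ℕ) (hd : 1 ≤ d) (hk : 1 ≤ k)
    (lam : Fin k → Fin d → ℝ) (hlam : ∀ j i, 0 < lam j i)
    (alpha : Fin d → ℝ) (halpha : ∀ i, alpha i ∈ Set.Ioo (0 : ℝ) 1)
    (t : Fin d → ℝ) (ht : ∀ i, 0 ≤ t i) (u : ℝ) (hu : |u| ≤ 1) :
    ∑' n : ℕ, pAlpha d k lam alpha n t * u ^ n
      = Real.exp (-(∑ i, t i * (∑ j : Fin k, lam j i * (1 - u ^ (j.1 + 1))) ^ alpha i)) := by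
  rw [← Finset.sum_neg_distrib, Real.exp_sum]
  have h := (hasSum_pi_prod fun i => hasSum_pgf_factor hk (fun j => hlam j i) (halpha i).1
    (halpha i).2.le (ht i) hu).tsum_ite_fiberwise fun m : Fin d → ℕ => ∑ i, m i
  rw [← h.tsum_eq]
  refine tsum_congr fun n => ?_
  rw [pAlpha, ← tsum_mul_right]
  refine tsum_congr fun m => ?_
  split_ifs with hm
  · rw [Finset.prod_mul_distrib, Finset.prod_pow_eq_pow_sum, hm]
  · exact zero_mul _
end

section
/- For all α = (α_1,…,α_d) ∈ (0,1)^d, every i ∈ {1,…,d}, every n ∈ ℕ_0 and every t ∈ ℝ_+^d, the distribution p^α satisfies the differential equation ∂/∂t_i p^α(n,t) = −μ_i^{α_i} Σ_{r=0}^∞ C(α_i, r) (−1/μ_i)^r Σ_{r_1+⋯+r_k = r, r_j ∈ ℕ_0} r! (∏_{j=1}^k λ_{ji}^{r_j}/r_j!) p^α(n − Σ_{j=1}^k j r_j, t), where p^α(m,t) := 0 for m < 0 and C(α, r) = α(α−1)⋯(α−r+1)/r! is the generalized binomial coefficient; equivalently ∂/∂t_i p^α(n,t) = −(Σ_{j=1}^k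 λ_{ji}(I − B^j))^{α_i} p^α(n,t) with B the backward shift operator in n, and the initial conditions p^α(0,0) = 1 and p^α(n,0) = 0 for n ≥ 1 hold. -/
open scoped BigOperators

/-- `p^α(m,t)` extended to integer arguments by `p^α(m,t) = 0` for `m < 0`. -/
noncomputable def pAlphaZ (d k : ℕ) (lam : Fin k → Fin d → ℝ) (alpha : Fin d → ℝ)
    (m : ℤ) (t : Fin d → ℝ) : ℝ :=
  if 0 ≤ m then pAlpha d k lam alpha m.toNat t else 0

/-- The generalized binomial coefficient `C(α,r) = α(α−1)⋯(α−r+1)/r!`. -/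
noncomputable def genBinom (a : ℝ) (r : ℕ) : ℝ :=
  (∏ m ∈ Finset.range r, (a - m)) / (Nat.factorial r)

section

open PowerSeries Finset

lemma genBinom_eq_choose (a : ℝ) (r : ℕ) : genBinom a r = Ring.choose a r := by
  have h : ∀ r : ℕ, (descPochhammer ℤ r).smeval a = ∏ m ∈ range r, (a - m) := by
    intro r
    induction r with
    | zero => simp
    | succ r ih =>
      rw [descPochhammer_succ_right, Polynomial.smeval_mul, ih, prod_range_succ,
        Polynomial.smeval_sub, Polynomial.smeval_X, Polynomial.smeval_natCast]
      simp
  rw [genBinom, Ring.choose_eq_smul, h, smul_eq_mul, div_eq_inv_mul]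

lemma gamma_div_gamma_sub_natCast (y : ℝ) (hy : 0 ≤ y) (s : ℕ) :
    Real.Gamma (y + 1) / Real.Gamma (y + 1 - s) = ∏ m ∈ range s, (y - m) := by
  induction s with
  | zero => simp [div_self (Real.Gamma_pos_of_pos (by positivity : 0 < y + 1)).ne']
  | succ s ih =>
    rw [prod_range_succ, ← ih]
    have e : y + 1 - ((s + 1 : ℕ) : ℝ) = y - s := by push_cast; ring
    have e' : y + 1 - (s : ℝ) = y - s + 1 := by ring
    rw [e, e']
    rcases eq_or_ne (y - s) 0 with h | h
    · simp [h, Real.Gamma_zero]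
    · rw [Real.Gamma_add_one h]
      field_simp

lemma abs_genBinom_mul_natCast_le {a : ℝ} (h0 : 0 ≤ a) (h1 : a ≤ 1) (s r : ℕ) :
    |genBinom (a * r) s| ≤ Real.exp s * Real.exp 1 ^ r := by
  have hprod : |∏ m ∈ range s, (a * r - m)| ≤ ((r : ℝ) + s) ^ s := by
    rw [abs_prod]
    calc ∏ m ∈ range s, |a * r - m| ≤ ∏ _m ∈ range s, ((r : ℝ) + s) := by
          refine prod_le_prod (fun _ _ => abs_nonneg _) fun m hm => ?_
          have hm' : (m : ℝ) ≤ s := by exact_mod_cast (mem_range.1 hm).le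
          have hr : (0 : ℝ) ≤ r := r.cast_nonneg
          have hm0 : (0 : ℝ) ≤ m := m.cast_nonneg
          have : a * r ≤ r := mul_le_of_le_one_left hr h1
          have : 0 ≤ a * r := by positivity
          rw [abs_le]
          constructor <;> linarith
      _ = _ := by simp
  rw [genBinom, abs_div, Nat.abs_cast]
  calc _ ≤ ((r : ℝ) + s) ^ s / (s.factorial : ℝ) := by gcongr
    _ ≤ Real.exp (r + s) := Real.pow_div_factorial_le_exp _ (by positivity) s
    _ = _ := by rw [Real.exp_add, mul_comm, ← Real.exp_nat_mul, mul_one]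

lemma summable_pow_div_factorial_mul {g : ℕ → ℝ} {K M : ℝ} (hg : ∀ r, |g r| ≤ K * M ^ r)
    (z : ℝ) : Summable fun r : ℕ => z ^ r / r.factorial * g r := by
  refine Summable.of_norm_bounded ((Real.summable_pow_div_factorial (|z| * M)).mul_left K)
    fun r => ?_
  rw [norm_mul, norm_div, norm_pow, Real.norm_eq_abs, Real.norm_eq_abs, Real.norm_eq_abs,
    Nat.abs_cast]
  calc |z| ^ r / r.factorial * |g r| ≤ |z| ^ r / r.factorial * (K * M ^ r) := by
        gcongr; exact hg r
    _ = _ := by rw [mul_pow]; ring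

lemma hasDerivAt_tsum_pow_div_factorial_mul {g : ℕ → ℝ} {K M : ℝ}
    (hg : ∀ r, |g r| ≤ K * M ^ r) (z : ℝ) :
    HasDerivAt (fun z : ℝ => ∑' r : ℕ, z ^ r / r.factorial * g r)
      (∑' r : ℕ, z ^ r / r.factorial * g (r + 1)) z := by
  have hg' : ∀ r, |g (r + 1)| ≤ K * M * M ^ r := fun r => (hg (r + 1)).trans_eq (by ring)
  have hfun : (fun z : ℝ => ∑' r : ℕ, z ^ r / r.factorial * g r) =
      fun z : ℝ => g 0 + ∑' r : ℕ, z ^ (r + 1) / (r + 1).factorial * g (r + 1) := by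
    funext z
    rw [(summable_pow_div_factorial_mul hg z).tsum_eq_zero_add]
    simp
  rw [hfun]
  refine HasDerivAt.const_add _ ?_
  have hz : z ∈ Metric.ball (0 : ℝ) (|z| + 1) := by simp
  refine hasDerivAt_tsum_of_isPreconnected (g' := fun r z => z ^ r / r.factorial * g (r + 1))
    (u := fun r => (|z| + 1) ^ r / r.factorial * |g (r + 1)|)
    (t := Metric.ball (0 : ℝ) (|z| + 1)) ?_ Metric.isOpen_ball
    (convex_ball _ _).isPreconnected ?_ ?_ hz
    ((summable_nat_add_iff 1).2 (summable_pow_div_factorial_mul hg z)) hz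
  · exact summable_pow_div_factorial_mul (by simpa using hg') _
  · intro r y _
    have h := (((hasDerivAt_id y).pow (r + 1)).div_const ((r + 1).factorial : ℝ)).mul_const
      (g (r + 1))
    refine h.congr_deriv ?_
    have : ((r + 1).factorial : ℝ) = (r + 1) * r.factorial := by
      rw [Nat.factorial_succ]; push_cast; ring
    rw [this]
    have h1 : (r : ℝ) + 1 ≠ 0 := by positivity
    simp only [Nat.cast_add, Nat.cast_one, id_eq, add_tsub_cancel_right, mul_one]
    field_simp
  · intro r y hy
    have hy' : |y| ≤ |z| + 1 := by simpa using (mem_ball_zero_iff.1 hy).le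
    rw [norm_mul, norm_div, norm_pow, Real.norm_eq_abs, Real.norm_eq_abs, Real.norm_eq_abs,
      Nat.abs_cast]
    gcongr

/-- The power series `(1 + L)^y` (meaningful when `L` has no constant term). -/
noncomputable def onePlusPow (L : PowerSeries ℝ) (y : ℝ) : PowerSeries ℝ :=
  (PowerSeries.binomialSeries ℝ y).subst L

lemma onePlusPow_add {L : PowerSeries ℝ} (hL : constantCoeff L = 0) (y z : ℝ) :
    onePlusPow L (y + z) = onePlusPow L y * onePlusPow L z := by
  rw [onePlusPow, PowerSeries.binomialSeries_add, subst_mul (HasSubst.of_constantCoeff_zero' hL)]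
  rfl

lemma onePlusPow_zero {L : PowerSeries ℝ} (hL : constantCoeff L = 0) :
    onePlusPow L 0 = 1 := by
  rw [onePlusPow, PowerSeries.binomialSeries_zero,
    ← coe_substAlgHom (HasSubst.of_constantCoeff_zero' hL), map_one]

lemma coeff_pow_of_lt {L : PowerSeries ℝ} (hL : constantCoeff L = 0) {n r : ℕ} (h : n < r) :
    coeff n (L ^ r) = 0 := by
  refine coeff_of_lt_order _ (lt_of_lt_of_le ?_ (le_order_pow_of_constantCoeff_eq_zero r hL))
  exact_mod_cast h

lemma coeff_onePlusPow {L : PowerSeries ℝ} (hL : constantCoeff L = 0) (y : ℝ) {n N : ℕ}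
    (h : n ≤ N) :
    coeff n (onePlusPow L y) = ∑ r ∈ range (N + 1), genBinom y r * coeff n (L ^ r) := by
  rw [onePlusPow, coeff_subst' (HasSubst.of_constantCoeff_zero' hL),
    finsum_eq_sum_of_support_subset (s := range (N + 1))]
  · simp [genBinom_eq_choose]
  · intro r hr
    by_contra hr'
    refine hr ?_
    have : n < r := by simp at hr'; omega
    simp [coeff_pow_of_lt hL this]

lemma coeff_onePlusPow_mul {L : PowerSeries ℝ} (hL : constantCoeff L = 0) (y : ℝ)
    (P : PowerSeries ℝ) (n : ℕ) :
    coeff n (onePlusPow L y * P) =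
      ∑ r ∈ range (n + 1), genBinom y r * coeff n (L ^ r * P) := by
  simp_rw [coeff_mul, mul_sum]
  rw [sum_comm]
  refine sum_congr rfl fun p hp => ?_
  rw [coeff_onePlusPow hL y (Finset.HasAntidiagonal.antidiagonal.fst_le hp), sum_mul]
  simp_rw [mul_assoc]

/-- The coefficients `c_n(r) = [X^n] (1 + L)^{a r}` grow at most geometrically in `r`. -/
lemma exists_abs_coeff_onePlusPow_le {L : PowerSeries ℝ} (hL : constantCoeff L = 0) {a : ℝ}
    (h0 : 0 ≤ a) (h1 : a ≤ 1) (n : ℕ) :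
    ∃ K, ∀ r : ℕ, |coeff n (onePlusPow L (a * r))| ≤ K * Real.exp 1 ^ r := by
  refine ⟨∑ s ∈ range (n + 1), Real.exp s * |coeff n (L ^ s)|, fun r => ?_⟩
  rw [coeff_onePlusPow hL _ le_rfl, sum_mul]
  refine (abs_sum_le_sum_abs _ _).trans (sum_le_sum fun s _ => ?_)
  rw [abs_mul, mul_right_comm]
  gcongr
  exact abs_genBinom_mul_natCast_le h0 h1 s r

/-- The power series `exp (z (1 + L)^a)`, with coefficients given by the exponential series. -/
noncomputable def expOnePlusPow (L : PowerSeries ℝ) (a z : ℝ) : PowerSeries ℝ :=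
  mk fun n => ∑' r : ℕ, z ^ r / r.factorial * coeff n (onePlusPow L (a * r))

lemma expOnePlusPow_zero {L : PowerSeries ℝ} (hL : constantCoeff L = 0) (a : ℝ) :
    expOnePlusPow L a 0 = 1 := by
  ext n
  rw [expOnePlusPow, coeff_mk, tsum_eq_single 0 fun r hr => by simp [hr]]
  simp [onePlusPow_zero hL]

lemma hasDerivAt_coeff_expOnePlusPow {L : PowerSeries ℝ} (hL : constantCoeff L = 0) {a : ℝ}
    (h0 : 0 ≤ a) (h1 : a ≤ 1) (n : ℕ) (z : ℝ) :
    HasDerivAt (fun z => coeff n (expOnePlusPow L a z))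
      (coeff n (onePlusPow L a * expOnePlusPow L a z)) z := by
  obtain ⟨K, hK⟩ := exists_abs_coeff_onePlusPow_le hL h0 h1 n
  simp only [expOnePlusPow, coeff_mk, coeff_mul]
  convert hasDerivAt_tsum_pow_div_factorial_mul hK z using 1
  simp_rw [← tsum_mul_left]
  rw [← Summable.tsum_finsetSum]
  · refine tsum_congr fun r => ?_
    have : a * ((r + 1 : ℕ) : ℝ) = a + a * r := by push_cast; ring
    rw [this, onePlusPow_add hL, coeff_mul, mul_sum]
    exact sum_congr rfl fun p _ => by ring
  · intro p _
    obtain ⟨K', hK'⟩ := exists_abs_coeff_onePlusPow_le hL h0 h1 p.2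
    exact (summable_pow_div_factorial_mul hK' z).mul_left _

/-- The power series `∑ j, a_j X^{j+1}`, with `j` running from `0`. -/
noncomputable def jumpSeries {k : ℕ} (a : Fin k → ℝ) : PowerSeries ℝ :=
  ∑ j, C (a j) * X ^ (j.1 + 1)

lemma constantCoeff_jumpSeries {k : ℕ} (a : Fin k → ℝ) : constantCoeff (jumpSeries a) = 0 := by
  simp [jumpSeries]

lemma coeff_jumpSeries_pow_mul {k : ℕ} (a : Fin k → ℝ) (P : PowerSeries ℝ) (n r : ℕ) :
    coeff n (jumpSeries a ^ r * P) = ∑ x ∈ piAntidiag univ r,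
      (r.factorial : ℝ) * (∏ j, a j ^ x j / (x j).factorial) *
        if ∑ j, (j.1 + 1) * x j ≤ n then coeff (n - ∑ j, (j.1 + 1) * x j) P else 0 := by
  rw [jumpSeries, sum_pow_eq_sum_piAntidiag, sum_mul, map_sum]
  refine sum_congr rfl fun x hx => ?_
  have hmult : (Nat.multinomial univ x : ℝ) * ∏ j, ((x j).factorial : ℝ) = r.factorial := by
    have h := Nat.multinomial_spec univ x
    rw [(mem_piAntidiag.1 hx).1] at h
    rw [← h]
    push_cast
    ring
  have hne : ∏ j, ((x j).factorial : ℝ) ≠ 0 :=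
    prod_ne_zero_iff.2 fun j _ => by positivity
  have hterm : ((Nat.multinomial univ x : ℕ) : PowerSeries ℝ) *
      ∏ j : Fin k, (C (a j) * X ^ (j.1 + 1)) ^ x j =
      C ((r.factorial : ℝ) * ∏ j, a j ^ x j / (x j).factorial) *
        X ^ (∑ j : Fin k, (j.1 + 1) * x j) := by
    simp_rw [mul_pow, prod_mul_distrib, ← pow_mul, prod_pow_eq_pow_sum, ← map_pow, ← map_prod]
    rw [prod_div_distrib, ← hmult, ← map_natCast (C (R := ℝ)), ← mul_assoc, ← map_mul]
    congr 2
    field_simp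
  rw [hterm, mul_assoc, coeff_C_mul, coeff_X_pow_mul']

lemma tsum_ite_sum_eq {k : ℕ} (r : ℕ) (g : (Fin k → ℕ) → ℝ) :
    (∑' x : Fin k → ℕ, if ∑ j, x j = r then g x else 0) = ∑ x ∈ piAntidiag univ r, g x := by
  rw [tsum_eq_sum (s := piAntidiag univ r) fun x hx => by
    rw [if_neg]; simpa [mem_piAntidiag] using hx]
  exact sum_congr rfl fun x hx => if_pos (mem_piAntidiag.1 hx).1

lemma tsum_eq_sum_range_sum_piAntidiag {k : ℕ} (n : ℕ) (g : (Fin k → ℕ) → ℝ)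
    (hg : ∀ x, n < ∑ j, x j → g x = 0) :
    ∑' x, g x = ∑ r ∈ range (n + 1), ∑ x ∈ piAntidiag univ r, g x := by
  classical
  rw [← sum_biUnion]
  · refine tsum_eq_sum fun x hx => hg x ?_
    simp [mem_piAntidiag] at hx
    omega
  · intro r _ s _ hrs
    refine disjoint_left.2 fun x hx hx' => hrs ?_
    rw [← (mem_piAntidiag.1 hx).1, ← (mem_piAntidiag.1 hx').1]

lemma sum_le_weight {k : ℕ} (x : Fin k → ℕ) : ∑ j, x j ≤ ∑ j, (j.1 + 1) * x j :=
  sum_le_sum fun j _ => Nat.le_mul_of_pos_left _ j.1.succ_pos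

lemma coeff_onePlusPow_jumpSeries {k : ℕ} (a : Fin k → ℝ) (y : ℝ) (n : ℕ) :
    coeff n (onePlusPow (jumpSeries a) y) = ∑ s ∈ range (n + 1), ∑ x ∈ piAntidiag univ s,
      if ∑ j, (j.1 + 1) * x j = n then
        (∏ j, a j ^ x j / (x j).factorial) * (s.factorial * genBinom y s) else 0 := by
  rw [coeff_onePlusPow (constantCoeff_jumpSeries a) y le_rfl]
  refine sum_congr rfl fun s _ => ?_
  rw [← mul_one (jumpSeries a ^ s), coeff_jumpSeries_pow_mul, mul_sum]
  refine sum_congr rfl fun x _ => ?_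
  simp only [coeff_one]
  split_ifs <;> first | omega | ring

lemma tsum_weight_eq_coeff_expOnePlusPow {k : ℕ} (a : Fin k → ℝ) {α : ℝ} (h0 : 0 ≤ α)
    (h1 : α ≤ 1) (z : ℝ) (n : ℕ) :
    (∑' x : Fin k → ℕ,
      if (∑ j, (j.1 + 1) * x j) = n then
        (∏ j, a j ^ (x j) / (Nat.factorial (x j))) *
          ∑' r : ℕ, z ^ r * Real.Gamma (α * r + 1) /
            ((Nat.factorial r) * Real.Gamma (α * r + 1 - ∑ j, (x j : ℝ)))
      else 0) = coeff n (expOnePlusPow (jumpSeries a) α z) := by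
  have hsum : ∀ s : ℕ, Summable fun r : ℕ => z ^ r / r.factorial * genBinom (α * r) s :=
    fun s => summable_pow_div_factorial_mul (abs_genBinom_mul_natCast_le h0 h1 s) z
  have hterm : ∀ s : ℕ, ∀ x ∈ piAntidiag (univ : Finset (Fin k)) s,
      ∑' r : ℕ, z ^ r * Real.Gamma (α * r + 1) /
        ((Nat.factorial r) * Real.Gamma (α * r + 1 - ∑ j, (x j : ℝ))) =
      s.factorial * ∑' r : ℕ, z ^ r / r.factorial * genBinom (α * r) s := by
    intro s x hx
    have hs : ∑ j, (x j : ℝ) = s := by exact_mod_cast (mem_piAntidiag.1 hx).1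
    rw [← tsum_mul_left]
    refine tsum_congr fun r => ?_
    rw [hs, mul_div_mul_comm, gamma_div_gamma_sub_natCast _ (by positivity), genBinom]
    have : (s.factorial : ℝ) ≠ 0 := by positivity
    field_simp
  rw [tsum_eq_sum_range_sum_piAntidiag n _ fun x hx => if_neg fun h => by
    have := sum_le_weight x; omega]
  rw [expOnePlusPow, coeff_mk]
  simp_rw [coeff_onePlusPow_jumpSeries, mul_sum]
  rw [Summable.tsum_finsetSum]
  · refine sum_congr rfl fun s _ => ?_
    rw [Summable.tsum_finsetSum]
    · refine sum_congr rfl fun x hx => ?_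
      split_ifs
      · rw [hterm s x hx, ← tsum_mul_left, ← tsum_mul_left]
        exact tsum_congr fun r => by ring
      · simp
    · intro x _
      split_ifs
      · exact ((hsum s).mul_left ((∏ j, a j ^ x j / (x j).factorial) * s.factorial)).congr
          fun r => by ring
      · simp
  · intro s _
    refine summable_sum fun x _ => ?_
    split_ifs
    · exact ((hsum s).mul_left ((∏ j, a j ^ x j / (x j).factorial) * s.factorial)).congr
        fun r => by ring
    · simp

lemma coeff_prod_univ {d : ℕ} (Q : Fin d → PowerSeries ℝ) (n : ℕ) :
    coeff n (∏ i, Q i) = ∑ m ∈ piAntidiag univ n, ∏ i, coeff (m i) (Q i) := by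
  rw [coeff_prod]
  refine sum_bij (fun l _ => ⇑l) (fun l hl => ?_) (fun _ _ _ _ h => DFunLike.coe_injective h)
    (fun m hm => ⟨Finsupp.equivFunOnFinite.symm m, ?_, rfl⟩) fun _ _ => rfl
  · simpa [mem_piAntidiag] using hl
  · simpa [mem_piAntidiag] using hm

/-- The ratios `-λ_{ji} / μ_i` for a fixed `i`. -/
noncomputable def negRatio {d k : ℕ} (lam : Fin k → Fin d → ℝ) (i : Fin d) : Fin k → ℝ :=
  fun j => -(lam j i) / ∑ j', lam j' i

/-- The generating function of `n ↦ p^α(n, t)`. -/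
noncomputable def pAlphaSeries {d k : ℕ} (lam : Fin k → Fin d → ℝ) (alpha : Fin d → ℝ)
    (t : Fin d → ℝ) : PowerSeries ℝ :=
  ∏ i, expOnePlusPow (jumpSeries (negRatio lam i)) (alpha i)
    (-((∑ j', lam j' i) ^ alpha i) * t i)

lemma pAlpha_eq_coeff {d k : ℕ} (lam : Fin k → Fin d → ℝ) {alpha : Fin d → ℝ}
    (halpha : ∀ i, alpha i ∈ Set.Ioo (0 : ℝ) 1) (n : ℕ) (t : Fin d → ℝ) :
    pAlpha d k lam alpha n t = coeff n (pAlphaSeries lam alpha t) := by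
  rw [pAlpha, tsum_ite_sum_eq, pAlphaSeries, coeff_prod_univ]
  refine sum_congr rfl fun m _ => prod_congr rfl fun i _ => ?_
  exact tsum_weight_eq_coeff_expOnePlusPow (negRatio lam i) (halpha i).1.le (halpha i).2.le _ _

lemma pAlphaSeries_zero {d k : ℕ} (lam : Fin k → Fin d → ℝ) (alpha : Fin d → ℝ) :
    pAlphaSeries lam alpha 0 = 1 := by
  simp [pAlphaSeries, expOnePlusPow_zero, constantCoeff_jumpSeries]

lemma hasDerivAt_coeff_pAlphaSeries {d k : ℕ} (lam : Fin k → Fin d → ℝ) {alpha : Fin d → ℝ}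
    (halpha : ∀ i, alpha i ∈ Set.Ioo (0 : ℝ) 1) (i : Fin d) (n : ℕ) (t : Fin d → ℝ) :
    HasDerivAt (fun s => coeff n (pAlphaSeries lam alpha (Function.update t i s)))
      (-((∑ j', lam j' i) ^ alpha i) * coeff n
        (onePlusPow (jumpSeries (negRatio lam i)) (alpha i) * pAlphaSeries lam alpha t)) (t i) := by
  set c := -((∑ j', lam j' i) ^ alpha i) with hc
  set Q := fun z => expOnePlusPow (jumpSeries (negRatio lam i)) (alpha i) z with hQ
  set R := ∏ i' ∈ univ.erase i, expOnePlusPow (jumpSeries (negRatio lam i')) (alpha i')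
    (-((∑ j', lam j' i') ^ alpha i') * t i') with hR
  have hsplit : ∀ s, pAlphaSeries lam alpha (Function.update t i s) = Q (c * s) * R := by
    intro s
    rw [pAlphaSeries, ← mul_prod_erase univ _ (mem_univ i), Function.update_self]
    congr 1
    exact prod_congr rfl fun i' hi' => by rw [Function.update_of_ne (ne_of_mem_erase hi')]
  have ht : pAlphaSeries lam alpha t = Q (c * t i) * R := by
    rw [← hsplit, Function.update_eq_self]
  simp_rw [hsplit, ht, ← mul_assoc]
  rw [mul_comm c]
  simp_rw [coeff_mul _ _ R]
  rw [sum_mul]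
  refine HasDerivAt.fun_sum fun p _ => ?_
  rw [mul_right_comm]
  refine HasDerivAt.mul_const ?_ _
  have hd := hasDerivAt_coeff_expOnePlusPow (constantCoeff_jumpSeries (negRatio lam i))
    (halpha i).1.le (halpha i).2.le p.1 (c * t i)
  exact hd.comp (t i) (by simpa using (hasDerivAt_id (t i)).const_mul c)

lemma coeff_onePlusPow_mul_pAlphaSeries {d k : ℕ} (lam : Fin k → Fin d → ℝ)
    {alpha : Fin d → ℝ} (halpha : ∀ i, alpha i ∈ Set.Ioo (0 : ℝ) 1) (i : Fin d) (n : ℕ)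
    (t : Fin d → ℝ) :
    (∑' r : ℕ, genBinom (alpha i) r * (-1 / (∑ j', lam j' i)) ^ r *
      ∑' x : Fin k → ℕ,
        if (∑ j, x j) = r then
          (Nat.factorial r : ℝ) * (∏ j, lam j i ^ (x j) / (Nat.factorial (x j))) *
            pAlphaZ d k lam alpha ((n : ℤ) - ∑ j, ((j.1 : ℤ) + 1) * (x j : ℤ)) t
        else 0) =
      coeff n (onePlusPow (jumpSeries (negRatio lam i)) (alpha i) * pAlphaSeries lam alpha t) := by
  have hZ : ∀ x : Fin k → ℕ,
      pAlphaZ d k lam alpha ((n : ℤ) - ∑ j, ((j.1 : ℤ) + 1) * (x j : ℤ)) t =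
        if ∑ j, (j.1 + 1) * x j ≤ n then
          coeff (n - ∑ j, (j.1 + 1) * x j) (pAlphaSeries lam alpha t) else 0 := by
    intro x
    have hcast : ∑ j : Fin k, ((j.1 : ℤ) + 1) * (x j : ℤ) =
        ((∑ j : Fin k, (j.1 + 1) * x j : ℕ) : ℤ) := by push_cast; rfl
    rw [pAlphaZ, hcast]
    split_ifs with h h' h'
    · rw [pAlpha_eq_coeff lam halpha]
      congr 2
      omega
    · omega
    · omega
    · rfl
  have hterm : ∀ r : ℕ, genBinom (alpha i) r * (-1 / (∑ j', lam j' i)) ^ r *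
      ∑' x : Fin k → ℕ,
        (if (∑ j, x j) = r then
          (Nat.factorial r : ℝ) * (∏ j, lam j i ^ (x j) / (Nat.factorial (x j))) *
            pAlphaZ d k lam alpha ((n : ℤ) - ∑ j, ((j.1 : ℤ) + 1) * (x j : ℤ)) t
        else 0) =
      genBinom (alpha i) r *
        coeff n (jumpSeries (negRatio lam i) ^ r * pAlphaSeries lam alpha t) := by
    intro r
    rw [tsum_ite_sum_eq, coeff_jumpSeries_pow_mul, mul_assoc, mul_sum]
    congr 1
    refine sum_congr rfl fun x hx => ?_
    have hprod : (∏ j, negRatio lam i j ^ x j / ((x j).factorial : ℝ)) =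
        (-1 / ∑ j', lam j' i) ^ r * ∏ j, lam j i ^ x j / ((x j).factorial : ℝ) := by
      rw [← (mem_piAntidiag.1 hx).1, ← prod_pow_eq_pow_sum, ← prod_mul_distrib]
      refine prod_congr rfl fun j _ => ?_
      have : negRatio lam i j = -1 / (∑ j', lam j' i) * lam j i := by rw [negRatio]; ring
      rw [this, mul_pow, mul_div_assoc]
    rw [hZ, hprod]
    ring
  simp_rw [hterm]
  rw [coeff_onePlusPow_mul (constantCoeff_jumpSeries _)]
  refine tsum_eq_sum fun r hr => ?_
  rw [coeff_mul, sum_eq_zero, mul_zero]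
  intro p hp
  have : p.1 < r := by
    have := Finset.HasAntidiagonal.antidiagonal.fst_le hp
    simp at hr
    omega
  rw [coeff_pow_of_lt (constantCoeff_jumpSeries _) this, zero_mul]

end

/-- For all `α ∈ (0,1)^d`, every `i`, every `n ∈ ℕ_0` and every `t ∈ ℝ_+^d`, the
distribution `p^α` satisfies
`∂/∂t_i p^α(n,t) = −μ_i^{α_i} Σ_{r=0}^∞ C(α_i,r)(−1/μ_i)^r
  Σ_{r_1+⋯+r_k=r} r! (∏_j λ_{ji}^{r_j}/r_j!) p^α(n − Σ_j j r_j, t)`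
(with `p^α(m,t) := 0` for `m < 0`), i.e.
`∂/∂t_i p^α(n,t) = −(Σ_j λ_{ji}(I − B^j))^{α_i} p^α(n,t)`, together with the initial
conditions `p^α(0,0) = 1` and `p^α(n,0) = 0` for `n ≥ 1`. -/
theorem pAlpha_pde (d k : ℕ) (hd : 1 ≤ d) (hk : 1 ≤ k)
    (lam : Fin k → Fin d → ℝ) (hlam : ∀ j i, 0 < lam j i)
    (alpha : Fin d → ℝ) (halpha : ∀ i, alpha i ∈ Set.Ioo (0 : ℝ) 1) :
    (∀ (i : Fin d) (n : ℕ) (t : Fin d → ℝ), (∀ i', 0 ≤ t i') →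
      HasDerivAt (fun s : ℝ => pAlpha d k lam alpha n (Function.update t i s))
        (-((∑ j', lam j' i) ^ alpha i) *
          ∑' r : ℕ, genBinom (alpha i) r * (-1 / (∑ j', lam j' i)) ^ r *
            ∑' x : Fin k → ℕ,
              if (∑ j, x j) = r then
                (Nat.factorial r : ℝ) *
                  (∏ j, lam j i ^ (x j) / (Nat.factorial (x j))) *
                  pAlphaZ d k lam alpha ((n : ℤ) - ∑ j, ((j.1 : ℤ) + 1) * (x j : ℤ)) t
              else 0)
        (t i)) ∧
    pAlpha d k lam alpha 0 0 = 1 ∧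
    (∀ n : ℕ, 1 ≤ n → pAlpha d k lam alpha n 0 = 0) := by
  refine ⟨fun i n t _ => ?_, ?_, fun n hn => ?_⟩
  · simp_rw [pAlpha_eq_coeff lam halpha]
    rw [coeff_onePlusPow_mul_pAlphaSeries lam halpha]
    exact hasDerivAt_coeff_pAlphaSeries lam halpha i n t
  · rw [pAlpha_eq_coeff lam halpha, pAlphaSeries_zero, PowerSeries.coeff_zero_one]
  · rw [pAlpha_eq_coeff lam halpha, pAlphaSeries_zero, PowerSeries.coeff_one, if_neg (by omega)]
end

section
/- For all α = (α_1,…,α_d) ∈ (0,1)^d, every i ∈ {1,…,d}, every n ∈ ℕ_0 and every t ∈ ℝ_+^d with t_i > 0, the multiparameter fractional GCP distribution solves the Caputo fractional differential equation (1/Γ(1−α_i)) ∫_0^{t_i} (t_i − s)^{−α_i} (∂/∂s) p_α(n, t^{i}(s)) ds = −Σ_{j=1}^k λ_{ji} (p_α(n,t) − p_α(n−j,t)), where t^{i}(s) denotes the vector t with its i-th coordinate replaced by s, and p_α(m,t) := 0 for m < 0. -/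
open scoped BigOperators

/-- The three-parameter Mittag-Leffler function
`E^γ_{α,β}(x) = Σ_{r=0}^∞ Γ(r+γ) x^r / (Γ(γ) r! Γ(rα+β))`. -/
noncomputable def ml3 (a b c x : ℝ) : ℝ :=
  ∑' r : ℕ, Real.Gamma (r + c) * x ^ r /
    (Real.Gamma c * (Nat.factorial r) * Real.Gamma (r * a + b))

/-- The distribution of the multiparameter fractional GCP:
`p_α(n,t) = Σ_{(n_1,…,n_k) ∈ Ω(k,n)} Σ_{(n_{j1},…,n_{jd}) ∈ Θ(n_j,d), j = 1,…,k}
  ∏_i (Σ_j n_{ji})! (∏_j (λ_{ji} t_i^{α_i})^{n_{ji}}/n_{ji}!)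
       E^{Σ_j n_{ji}+1}_{α_i, α_i Σ_j n_{ji}+1}(−t_i^{α_i} Σ_j λ_{ji})`. -/
noncomputable def pFrac (d k : ℕ) (lam : Fin k → Fin d → ℝ) (alpha : Fin d → ℝ)
    (n : ℕ) (t : Fin d → ℝ) : ℝ :=
  ∑' y : Fin k → ℕ,
    if (∑ j, (j.1 + 1) * y j) = n then
      ∑' m : Fin k → Fin d → ℕ,
        if (∀ j, (∑ i, m j i) = y j) then
          ∏ i, ((Nat.factorial (∑ j, m j i) : ℝ) *
            (∏ j, (lam j i * t i ^ alpha i) ^ (m j i) / (Nat.factorial (m j i))) *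
            ml3 (alpha i) (alpha i * (∑ j, m j i) + 1) ((∑ j, m j i) + 1)
              (-(t i ^ alpha i) * ∑ j, lam j i))
        else 0
    else 0

/-- `p_α(m,t)` extended to integer arguments by `p_α(m,t) = 0` for `m < 0`. -/
noncomputable def pFracZ (d k : ℕ) (lam : Fin k → Fin d → ℝ) (alpha : Fin d → ℝ)
    (m : ℤ) (t : Fin d → ℝ) : ℝ :=
  if 0 ≤ m then pFrac d k lam alpha m.toNat t else 0

/-- The fractional power series `∑ₘ cₘ s^{am} / Γ(am + 1)`. -/
noncomputable def mlSeries (a : ℝ) (c : ℕ → ℝ) (s : ℝ) : ℝ :=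
  ∑' m : ℕ, c m * (s ^ (a * m) / Real.Gamma (a * m + 1))

/-- A real sequence of at most exponential growth. -/
def ExpBounded (c : ℕ → ℝ) : Prop :=
  ∃ C R : ℝ, 0 ≤ R ∧ ∀ m, |c m| ≤ C * R ^ m

lemma exp_neg_mul_rpow_le_Gamma {A y : ℝ} (hA : 0 ≤ A) (hy : 0 ≤ y) :
    Real.exp (-A) * A ^ y ≤ Real.Gamma (y + 1) := by
  have hint := Real.GammaIntegral_convergent (s := y + 1) (by linarith)
  rw [Real.Gamma_eq_integral (by linarith), ← integral_exp_neg_Ioi,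
    ← MeasureTheory.integral_mul_const]
  refine le_trans ?_ (MeasureTheory.setIntegral_mono_set hint ?_
    (Set.Ioi_subset_Ioi hA).eventuallyLE)
  · refine MeasureTheory.setIntegral_mono_on ?_ (hint.mono_set (Set.Ioi_subset_Ioi hA))
      measurableSet_Ioi fun x hx => ?_
    · exact (integrableOn_exp_neg_Ioi A).mul_const _
    · have hx' : A ≤ x := le_of_lt hx
      rw [add_sub_cancel_right]
      gcongr
  · filter_upwards [MeasureTheory.ae_restrict_mem measurableSet_Ioi] with x hx
    have : (0 : ℝ) ≤ x := le_of_lt hx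
    simp only [Pi.zero_apply]
    positivity

lemma summable_pow_div_Gamma {a : ℝ} (ha : 0 < a) {x : ℝ} (hx : 0 ≤ x) :
    Summable fun m : ℕ => x ^ m / Real.Gamma (a * m + 1) := by
  set A : ℝ := (2 * x + 1) ^ (1 / a) with hA
  have hA0 : 0 < A := by positivity
  have hAm : ∀ m : ℕ, A ^ (a * m) = (2 * x + 1) ^ m := fun m => by
    rw [hA, ← Real.rpow_mul (by positivity), ← mul_assoc, one_div, inv_mul_cancel₀ ha.ne',
      one_mul, Real.rpow_natCast]
  refine Summable.of_nonneg_of_le (f := fun m : ℕ => Real.exp A * (1 / 2) ^ m) (fun m => ?_)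
    (fun m => ?_) (summable_geometric_two.mul_left _)
  · have := Real.Gamma_pos_of_pos (s := a * m + 1) (by positivity)
    positivity
  · have h := exp_neg_mul_rpow_le_Gamma hA0.le (y := a * m) (by positivity)
    rw [hAm] at h
    rw [div_le_iff₀ (Real.Gamma_pos_of_pos (by positivity))]
    refine le_trans ?_ (mul_le_mul_of_nonneg_left h (by positivity))
    have : Real.exp A * (1 / 2) ^ m * (Real.exp (-A) * (2 * x + 1) ^ m)
        = (Real.exp A * Real.exp (-A)) * ((1 / 2) * (2 * x + 1)) ^ m := by
      rw [mul_pow]; ring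
    rw [this, ← Real.exp_add, add_neg_cancel, Real.exp_zero, one_mul]
    gcongr
    linarith

lemma rpow_mul_natCast_eq_pow {a s : ℝ} (hs : 0 ≤ s) (m : ℕ) :
    s ^ (a * m) = (s ^ a) ^ m := by
  rw [Real.rpow_mul hs, Real.rpow_natCast]

lemma ExpBounded.const_mul {c : ℕ → ℝ} (hc : ExpBounded c) (b : ℝ) :
    ExpBounded fun m => b * c m := by
  obtain ⟨C, R, hR, h⟩ := hc
  refine ⟨|b| * C, R, hR, fun m => ?_⟩
  rw [abs_mul, mul_assoc]
  gcongr
  exact h m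

lemma ExpBounded.add {c d : ℕ → ℝ} (hc : ExpBounded c) (hd : ExpBounded d) :
    ExpBounded fun m => c m + d m := by
  obtain ⟨C, R, hR, h⟩ := hc
  obtain ⟨D, S, hS, h'⟩ := hd
  have hC : 0 ≤ C := by simpa using (abs_nonneg _).trans (h 0)
  have hD : 0 ≤ D := by simpa using (abs_nonneg _).trans (h' 0)
  refine ⟨C + D, max R S, le_max_of_le_left hR, fun m => (abs_add_le _ _).trans ?_⟩
  rw [add_mul]
  refine add_le_add ((h m).trans ?_) ((h' m).trans ?_) <;> gcongr
  exacts [le_max_left _ _, le_max_right _ _]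

lemma ExpBounded.sum {ι : Type*} (S : Finset ι) {c : ι → ℕ → ℝ}
    (hc : ∀ x ∈ S, ExpBounded (c x)) : ExpBounded fun m => ∑ x ∈ S, c x m := by
  classical
  induction S using Finset.induction_on with
  | empty => exact ⟨0, 0, le_rfl, by simp⟩
  | insert x S hx ih =>
    simp only [Finset.sum_insert hx]
    exact (hc x (by simp)).add (ih fun y hy => hc y (Finset.mem_insert_of_mem hy))

lemma ExpBounded.summable_mul {c : ℕ → ℝ} (hc : ExpBounded c) {a x : ℝ} (ha : 0 < a)
    (hx : 0 ≤ x) : Summable fun m => |c m| * (x ^ m / Real.Gamma (a * m + 1)) := by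
  obtain ⟨C, R, hR, h⟩ := hc
  refine Summable.of_nonneg_of_le (fun m => ?_) (fun m => ?_)
    ((summable_pow_div_Gamma ha (mul_nonneg hR hx)).mul_left C)
  · have := Real.Gamma_pos_of_pos (s := a * m + 1) (by positivity)
    positivity
  · have := Real.Gamma_pos_of_pos (s := a * m + 1) (by positivity)
    rw [mul_pow, mul_div_assoc, ← mul_assoc]
    gcongr
    exact h m

lemma ExpBounded.natCast_mul {c : ℕ → ℝ} (hc : ExpBounded c) :
    ExpBounded fun m => (m : ℝ) * c m := by
  obtain ⟨C, R, hR, h⟩ := hc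
  refine ⟨C, 2 * R, by positivity, fun m => ?_⟩
  rw [abs_mul, Nat.abs_cast, mul_pow, mul_left_comm]
  have : (m : ℝ) ≤ 2 ^ m := by exact_mod_cast Nat.lt_two_pow_self.le
  exact mul_le_mul this (h m) (abs_nonneg _) (by positivity)

lemma ExpBounded.comp_succ {c : ℕ → ℝ} (hc : ExpBounded c) :
    ExpBounded fun m => c (m + 1) := by
  obtain ⟨C, R, hR, h⟩ := hc
  refine ⟨C * R, R, hR, fun m => (h (m + 1)).trans (le_of_eq (by ring))⟩

lemma ExpBounded.summable_mlSeries {c : ℕ → ℝ} (hc : ExpBounded c) {a s : ℝ} (ha : 0 < a)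
    (hs : 0 ≤ s) : Summable fun m : ℕ => c m * (s ^ (a * m) / Real.Gamma (a * m + 1)) := by
  refine Summable.of_norm ((hc.summable_mul ha (Real.rpow_nonneg hs a)).congr fun m => ?_)
  have := Real.Gamma_pos_of_pos (s := a * m + 1) (by positivity)
  have h2 := Real.rpow_nonneg hs (a * m)
  rw [Real.norm_eq_abs, abs_mul, abs_of_nonneg (a := s ^ (a * m) / _) (by positivity),
    rpow_mul_natCast_eq_pow hs]

lemma mlSeries_const_mul (a b : ℝ) (c : ℕ → ℝ) (s : ℝ) :
    mlSeries a (fun m => b * c m) s = b * mlSeries a c s := by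
  simp only [mlSeries, mul_assoc, tsum_mul_left]

lemma mlSeries_add {a s : ℝ} (ha : 0 < a) (hs : 0 ≤ s) {c d : ℕ → ℝ} (hc : ExpBounded c)
    (hd : ExpBounded d) :
    mlSeries a (fun m => c m + d m) s = mlSeries a c s + mlSeries a d s := by
  simp only [mlSeries, add_mul]
  exact (hc.summable_mlSeries ha hs).tsum_add (hd.summable_mlSeries ha hs)

lemma mlSeries_sum {ι : Type*} {a s : ℝ} (ha : 0 < a) (hs : 0 ≤ s) (S : Finset ι)
    {c : ι → ℕ → ℝ} (hc : ∀ x ∈ S, ExpBounded (c x)) :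
    mlSeries a (fun m => ∑ x ∈ S, c x m) s = ∑ x ∈ S, mlSeries a (c x) s := by
  simp only [mlSeries, Finset.sum_mul]
  exact Summable.tsum_finsetSum fun x hx => (hc x hx).summable_mlSeries ha hs

lemma hasDerivAt_mlSeries {a : ℝ} (ha : 0 < a) {c : ℕ → ℝ} (hc : ExpBounded c) {s : ℝ}
    (hs : 0 < s) :
    HasDerivAt (mlSeries a c)
      (∑' m : ℕ, c m * (a * m * s ^ (a * m - 1) / Real.Gamma (a * m + 1))) s := by
  have hmem : s ∈ Set.Ioo (s / 2) (2 * s) := ⟨by linarith, by linarith⟩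
  have hu := (hc.natCast_mul.summable_mul ha
    (Real.rpow_nonneg (show 0 ≤ 2 * s by linarith) a)).mul_left (a * (s / 2)⁻¹)
  refine hasDerivAt_tsum_of_isPreconnected
    (g := fun (m : ℕ) (y : ℝ) => c m * (y ^ (a * m) / Real.Gamma (a * m + 1)))
    (g' := fun (m : ℕ) (y : ℝ) => c m * (a * m * y ^ (a * m - 1) / Real.Gamma (a * m + 1)))
    hu isOpen_Ioo isPreconnected_Ioo (fun m y hy => ?_) (fun m y hy => ?_) hmem
    (hc.summable_mlSeries ha hs.le) hmem
  · have hy0 : 0 < y := lt_trans (by linarith) hy.1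
    exact ((Real.hasDerivAt_rpow_const (Or.inl hy0.ne')).div_const _).const_mul _
  · have hy0 : 0 < y := lt_trans (by linarith) hy.1
    have hΓ := Real.Gamma_pos_of_pos (s := a * m + 1) (by positivity)
    have hpow : y ^ (a * m - 1) ≤ ((2 * s) ^ a) ^ m * (s / 2)⁻¹ := by
      rw [Real.rpow_sub_one hy0.ne', div_eq_mul_inv, ← rpow_mul_natCast_eq_pow (by linarith)]
      have h1 := hy.1.le
      have h2 := hy.2.le
      gcongr
    rw [Real.norm_eq_abs, abs_mul, abs_mul, Nat.abs_cast,
      abs_of_nonneg (a := a * m * y ^ (a * m - 1) / _) (by positivity)]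
    calc |c m| * (a * m * y ^ (a * m - 1) / Real.Gamma (a * m + 1))
        ≤ |c m| * (a * m * (((2 * s) ^ a) ^ m * (s / 2)⁻¹) / Real.Gamma (a * m + 1)) := by
          gcongr
      _ = _ := by ring

lemma deriv_mlSeries {a : ℝ} (ha : 0 < a) {c : ℕ → ℝ} (hc : ExpBounded c) {s : ℝ}
    (hs : 0 < s) :
    deriv (mlSeries a c) s =
      ∑' m : ℕ, c (m + 1) * (s ^ (a * (m + 1) - 1) / Real.Gamma (a * (m + 1))) := by
  rw [(hasDerivAt_mlSeries ha hc hs).deriv]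
  rw [← Nat.succ_injective.tsum_eq]
  · refine tsum_congr fun m => ?_
    have h : (0 : ℝ) < a * (m + 1) := by positivity
    simp only [Nat.succ_eq_add_one, Nat.cast_add, Nat.cast_one]
    rw [Real.Gamma_add_one h.ne', mul_div_mul_left _ _ h.ne']
  · intro m hm
    cases m with
    | zero => simp at hm
    | succ m => exact ⟨m, rfl⟩

/-- The beta integral over `[0, t]`, in real form. -/
lemma integral_rpow_mul_sub_rpow {u v t : ℝ} (hu : 0 < u) (hv : 0 < v) (ht : 0 < t) :
    ∫ x in (0 : ℝ)..t, x ^ (u - 1) * (t - x) ^ (v - 1) =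
      t ^ (u + v - 1) * (Real.Gamma u * Real.Gamma v / Real.Gamma (u + v)) := by
  have h := Complex.betaIntegral_scaled (u : ℂ) v ht
  rw [Complex.betaIntegral_eq_Gamma_mul_div (u : ℂ) v (by simpa) (by simpa)] at h
  rw [← Complex.ofReal_inj, ← intervalIntegral.integral_ofReal]
  have hcast : ((t : ℂ) ^ ((u : ℂ) + v - 1)) = ((t ^ (u + v - 1) : ℝ) : ℂ) := by
    rw [Complex.ofReal_cpow ht.le]; push_cast; rfl
  rw [← Complex.ofReal_add, Complex.Gamma_ofReal, Complex.Gamma_ofReal, Complex.Gamma_ofReal,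
    Complex.ofReal_add, hcast] at h
  push_cast
  rw [← h]
  refine intervalIntegral.integral_congr fun x hx => ?_
  rw [Set.uIcc_of_le ht.le] at hx
  rw [Complex.ofReal_cpow hx.1, Complex.ofReal_cpow (sub_nonneg.2 hx.2)]
  push_cast
  rfl

/-- The Caputo derivative of order `a` shifts the coefficients of a fractional power series. -/
lemma caputo_mlSeries {a : ℝ} (ha : a ∈ Set.Ioo (0 : ℝ) 1) {c : ℕ → ℝ} (hc : ExpBounded c)
    {t : ℝ} (ht : 0 < t) :
    (1 / Real.Gamma (1 - a)) *
      ∫ s in (0 : ℝ)..t, (t - s) ^ (-a) * deriv (mlSeries a c) s =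
    mlSeries a (fun m => c (m + 1)) t := by
  have ha0 : 0 < a := ha.1
  have ha1 : 0 < 1 - a := sub_pos.2 ha.2
  have hΓ1 := Real.Gamma_pos_of_pos ha1
  set F : ℕ → ℝ → ℝ := fun m s => s ^ (a * (m + 1) - 1) * (t - s) ^ (-a) with hF
  have hFint : ∀ m, ∫ s in (0 : ℝ)..t, F m s = t ^ (a * m) *
      (Real.Gamma (a * (m + 1)) * Real.Gamma (1 - a) / Real.Gamma (a * m + 1)) := fun m => by
    have h := integral_rpow_mul_sub_rpow (u := a * (m + 1)) (v := 1 - a) (by positivity) ha1 ht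
    rwa [show 1 - a - 1 = -a by ring, show a * (m + 1) + (1 - a) - 1 = a * m by ring,
      show a * (m + 1) + (1 - a) = a * m + 1 by ring] at h
  have hFii : ∀ m, IntervalIntegrable (F m) MeasureTheory.volume 0 t := fun m => by
    refine intervalIntegral.intervalIntegrable_of_integral_ne_zero ?_
    rw [hFint]
    have h1 := Real.Gamma_pos_of_pos (s := a * (m + 1)) (by positivity)
    have h2 := Real.Gamma_pos_of_pos (s := a * m + 1) (by positivity)
    positivity
  set b : ℕ → ℝ := fun m => c (m + 1) / Real.Gamma (a * (m + 1)) with hb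
  have hterm : ∀ m, b m * ∫ s in Set.Ioc 0 t, F m s =
      Real.Gamma (1 - a) * (c (m + 1) * (t ^ (a * m) / Real.Gamma (a * m + 1))) := fun m => by
    have h1 := Real.Gamma_pos_of_pos (s := a * (m + 1)) (by positivity)
    rw [← intervalIntegral.integral_of_le ht.le, hFint, hb]
    field_simp
  have hnorm : ∀ m, ∫ s in Set.Ioc 0 t, ‖b m * F m s‖ = ‖b m * ∫ s in Set.Ioc 0 t, F m s‖ :=
    fun m => by
    have hpos : ∀ s ∈ Set.Ioc 0 t, 0 ≤ F m s := fun s hs =>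
      mul_nonneg (Real.rpow_nonneg hs.1.le _) (Real.rpow_nonneg (sub_nonneg.2 hs.2) _)
    rw [norm_mul, Real.norm_of_nonneg
      (MeasureTheory.setIntegral_nonneg measurableSet_Ioc hpos),
      ← MeasureTheory.integral_const_mul]
    refine MeasureTheory.setIntegral_congr_fun measurableSet_Ioc fun s hs => ?_
    rw [norm_mul, Real.norm_of_nonneg (hpos s hs)]
  have key := MeasureTheory.hasSum_integral_of_summable_integral_norm
    (μ := MeasureTheory.volume.restrict (Set.Ioc 0 t)) (F := fun m s => b m * F m s)
    (fun m => ((hFii m).1).const_mul _) (by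
      simp only [hnorm, hterm]
      exact ((hc.comp_succ.summable_mlSeries ha0 ht.le).mul_left _).norm)
  have hint : ∫ s in (0 : ℝ)..t, (t - s) ^ (-a) * deriv (mlSeries a c) s =
      ∫ s in Set.Ioc 0 t, ∑' m, b m * F m s := by
    rw [intervalIntegral.integral_of_le ht.le]
    refine MeasureTheory.setIntegral_congr_fun measurableSet_Ioc fun s hs => ?_
    rw [deriv_mlSeries ha0 hc hs.1, ← tsum_mul_left]
    refine tsum_congr fun m => ?_
    simp only [hb, hF]
    ring
  rw [hint, ← key.tsum_eq]
  simp only [MeasureTheory.integral_const_mul, hterm, tsum_mul_left]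
  rw [mlSeries]
  field_simp

/-- The factor of the fractional GCP distribution contributed by one time coordinate. -/
noncomputable def colFactor {k : ℕ} (l : Fin k → ℝ) (a : ℝ) (v : Fin k → ℕ) (s : ℝ) : ℝ :=
  (Nat.factorial (∑ j, v j) : ℝ) * (∏ j, (l j * s ^ a) ^ v j / (Nat.factorial (v j))) *
    ml3 a (a * (∑ j, v j) + 1) ((∑ j, v j) + 1) (-(s ^ a) * ∑ j, l j)

/-- The coefficients of `colFactor` as a fractional power series. -/
noncomputable def colCoeff {k : ℕ} (l : Fin k → ℝ) (v : Fin k → ℕ) (m : ℕ) : ℝ :=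
  (∏ j, l j ^ v j / (Nat.factorial (v j) : ℝ)) *
    (m.descFactorial (∑ j, v j) * (-∑ j, l j) ^ (m - ∑ j, v j))

lemma colFactor_eq_mlSeries {k : ℕ} (l : Fin k → ℝ) (a : ℝ) (v : Fin k → ℕ) {s : ℝ}
    (hs : 0 ≤ s) : colFactor l a v s = mlSeries a (colCoeff l v) s := by
  set N := ∑ j, v j with hN
  have hprod : ∏ j, (l j * s ^ a) ^ v j / (Nat.factorial (v j) : ℝ) =
      (s ^ a) ^ N * ∏ j, l j ^ v j / (Nat.factorial (v j) : ℝ) := by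
    rw [hN, ← Finset.prod_pow_eq_pow_sum, ← Finset.prod_mul_distrib]
    refine Finset.prod_congr rfl fun j _ => ?_
    rw [mul_pow]; ring
  have hshift : mlSeries a (colCoeff l v) s = ∑' r : ℕ, colCoeff l v (r + N) *
      (s ^ (a * (r + N : ℕ)) / Real.Gamma (a * (r + N : ℕ) + 1)) := by
    refine ((add_left_injective N).tsum_eq fun m hm => ?_).symm
    by_contra hlt
    have hmN : m < N := by
      by_contra! h
      exact hlt ⟨m - N, Nat.sub_add_cancel h⟩
    refine hm ?_
    simp [colCoeff, ← hN, Nat.descFactorial_eq_zero_iff_lt.2 hmN]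
  rw [hshift, colFactor, ml3, ← tsum_mul_left, ← hN, hprod]
  refine tsum_congr fun r => ?_
  have hΓ : Real.Gamma ((r : ℝ) + (N + 1)) = (Nat.factorial (r + N) : ℝ) := by
    rw [← Real.Gamma_nat_eq_factorial]; push_cast; ring_nf
  have hfac : (Nat.factorial r : ℝ) * ((r + N).descFactorial N : ℝ) = Nat.factorial (r + N) := by
    have := Nat.factorial_mul_descFactorial (Nat.le_add_left N r)
    rw [Nat.add_sub_cancel] at this
    exact_mod_cast this
  rw [hΓ, Real.Gamma_nat_eq_factorial, colCoeff, ← hN, Nat.add_sub_cancel,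
    rpow_mul_natCast_eq_pow hs, ← hfac,
    show (r : ℝ) * a + (a * N + 1) = a * ((r + N : ℕ) : ℝ) + 1 by push_cast; ring]
  have h1 : (Nat.factorial r : ℝ) ≠ 0 := by positivity
  have h2 : (Nat.factorial N : ℝ) ≠ 0 := by positivity
  rw [show -(s ^ a) * ∑ j, l j = s ^ a * (-∑ j, l j) by ring, mul_pow (s ^ a), pow_add]
  field_simp

lemma expBounded_colCoeff {k : ℕ} (l : Fin k → ℝ) (v : Fin k → ℕ) :
    ExpBounded (colCoeff l v) := by
  refine ExpBounded.const_mul ?_ _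
  set L := -∑ j, l j
  set N := ∑ j, v j
  refine ⟨Nat.factorial N, 2 * max 1 |L|, by positivity, fun m => ?_⟩
  rw [abs_mul, Nat.abs_cast, abs_pow, mul_pow, ← mul_assoc,
    Nat.descFactorial_eq_factorial_mul_choose, Nat.cast_mul]
  have h1 : ((m.choose N : ℕ) : ℝ) ≤ 2 ^ m := by exact_mod_cast Nat.choose_le_two_pow m N
  have h2 : |L| ^ (m - N) ≤ (max 1 |L|) ^ m :=
    (pow_le_pow_left₀ (abs_nonneg _) (le_max_right _ _) _).trans
      (pow_le_pow_right₀ (le_max_left _ _) (Nat.sub_le _ _))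
  gcongr

lemma mul_colCoeff_sub_single {k : ℕ} (l : Fin k → ℝ) (v : Fin k → ℕ) (m : ℕ) (j : Fin k) :
    (if 0 < v j then l j * colCoeff l (v - Pi.single j 1) m else 0) =
      v j * ((∏ j, l j ^ v j / (Nat.factorial (v j) : ℝ)) *
        (m.descFactorial (∑ j, v j - 1) * (-∑ j, l j) ^ (m - (∑ j, v j - 1)))) := by
  split_ifs with hj
  · obtain ⟨q, hq⟩ : ∃ q, v j = q + 1 := ⟨v j - 1, by omega⟩
    have hother : ∀ x ∈ Finset.univ.erase j,
        (v - Pi.single j 1 : Fin k → ℕ) x = v x := fun x hx => by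
      simp [Finset.ne_of_mem_erase hx]
    have hsum : ∑ x, (v - Pi.single j 1 : Fin k → ℕ) x = ∑ x, v x - 1 := by
      rw [← Finset.add_sum_erase _ _ (Finset.mem_univ j), Finset.sum_congr rfl hother,
        ← Finset.add_sum_erase _ (fun x => v x) (Finset.mem_univ j)]
      simp only [Pi.sub_apply, Pi.single_eq_same]
      exact tsub_add_eq_add_tsub hj
    have hprod : l j * ∏ x, l x ^ (v - Pi.single j 1 : Fin k → ℕ) x /
          (Nat.factorial ((v - Pi.single j 1 : Fin k → ℕ) x) : ℝ) =
        v j * ∏ x, l x ^ v x / (Nat.factorial (v x) : ℝ) := by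
      rw [← Finset.mul_prod_erase _ _ (Finset.mem_univ j),
        ← Finset.mul_prod_erase _ (fun x => l x ^ v x / (Nat.factorial (v x) : ℝ))
          (Finset.mem_univ j),
        Finset.prod_congr rfl fun x hx => by rw [hother x hx]]
      simp only [Pi.sub_apply, Pi.single_eq_same, hq, Nat.add_sub_cancel, Nat.factorial_succ]
      push_cast
      field_simp
      ring
    rw [colCoeff, hsum, ← mul_assoc, hprod, mul_assoc]
  · simp [show v j = 0 by omega]

lemma colCoeff_succ {k : ℕ} (l : Fin k → ℝ) (v : Fin k → ℕ) (m : ℕ) :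
    colCoeff l v (m + 1) = -(∑ j, l j) * colCoeff l v m +
      ∑ j, if 0 < v j then l j * colCoeff l (v - Pi.single j 1) m else 0 := by
  simp only [mul_colCoeff_sub_single, ← Finset.sum_mul]
  rw [← Nat.cast_sum, colCoeff, colCoeff]
  set L := ∑ j, l j
  set w := ∏ j, l j ^ v j / (Nat.factorial (v j) : ℝ)
  rcases hN : ∑ j, v j with _ | N
  · simp; ring
  · rw [Nat.succ_descFactorial_succ, Nat.descFactorial_succ, Nat.add_sub_cancel,
      Nat.add_sub_add_right]
    rcases lt_trichotomy m N with h | rfl | h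
    · simp [Nat.descFactorial_eq_zero_iff_lt.2 h]
    · simp; ring
    · obtain ⟨q, rfl⟩ := Nat.exists_eq_add_of_lt h
      rw [show N + q + 1 - N = q + 1 by omega, show N + q + 1 - (N + 1) = q by omega]
      push_cast
      ring

/-- The weight `∑ⱼ j ∑ᵢ nⱼᵢ` of a matrix of occupation numbers. -/
def matWeight {k d : ℕ} (m : Fin k → Fin d → ℕ) : ℕ := ∑ j, (j.1 + 1) * ∑ i, m j i

lemma finite_matWeight_eq (k d n : ℕ) : {m : Fin k → Fin d → ℕ | matWeight m = n}.Finite := by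
  refine (Set.finite_Iic (fun _ _ => n : Fin k → Fin d → ℕ)).subset fun m hm j i => ?_
  calc m j i ≤ ∑ i, m j i := Finset.single_le_sum (f := m j) (by simp) (Finset.mem_univ i)
    _ ≤ (j.1 + 1) * ∑ i, m j i := Nat.le_mul_of_pos_left _ (by omega)
    _ ≤ matWeight m := Finset.single_le_sum (f := fun j : Fin k => (j.1 + 1) * ∑ i, m j i)
        (by simp) (Finset.mem_univ j)
    _ = n := hm

/-- The finite set of matrices of occupation numbers of weight `n`. -/
noncomputable def matsOfWeight (k d n : ℕ) : Finset (Fin k → Fin d → ℕ) :=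
  (finite_matWeight_eq k d n).toFinset

@[simp]
lemma mem_matsOfWeight {k d n : ℕ} {m : Fin k → Fin d → ℕ} :
    m ∈ matsOfWeight k d n ↔ matWeight m = n := by
  simp [matsOfWeight]

lemma pFrac_eq_sum (d k : ℕ) (lam : Fin k → Fin d → ℝ) (alpha : Fin d → ℝ)
    (n : ℕ) (t : Fin d → ℝ) :
    pFrac d k lam alpha n t = ∑ m ∈ matsOfWeight k d n,
      ∏ i, colFactor (fun j => lam j i) (alpha i) (fun j => m j i) (t i) := by
  set P : (Fin k → Fin d → ℕ) → ℝ := fun m =>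
    ∏ i, colFactor (fun j => lam j i) (alpha i) (fun j => m j i) (t i) with hP
  have hrow : ∀ (m : Fin k → Fin d → ℕ) (y : Fin k → ℕ),
      (∀ j, ∑ i, m j i = y j) ↔ y = fun j => ∑ i, m j i := fun m y => by
    rw [funext_iff]
    simp only [eq_comm]
  have hterm : ∀ y : Fin k → ℕ,
      (if (∑ j, (j.1 + 1) * y j) = n then
        ∑' m : Fin k → Fin d → ℕ, if (∀ j, (∑ i, m j i) = y j) then P m else 0 else 0) =
      ∑ m ∈ matsOfWeight k d n, if y = fun j => ∑ i, m j i then P m else 0 := fun y => by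
    simp only [hrow]
    split_ifs with hy
    · refine tsum_eq_sum fun m hm => if_neg ?_
      rintro rfl
      exact hm (mem_matsOfWeight.2 hy)
    · refine (Finset.sum_eq_zero fun m hm => if_neg ?_).symm
      rintro rfl
      exact hy (mem_matsOfWeight.1 hm)
  refine (tsum_congr hterm).trans ?_
  rw [Summable.tsum_finsetSum fun m _ => (hasSum_ite_eq _ (P m)).summable]
  exact Finset.sum_congr rfl fun m _ => tsum_ite_eq _ _

lemma matWeight_add_single {k d : ℕ} (m : Fin k → Fin d → ℕ) (j : Fin k) (i : Fin d) :
    matWeight (m + Pi.single j (Pi.single i 1)) = matWeight m + (j.1 + 1) := by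
  simp only [matWeight, Pi.add_apply, Finset.sum_add_distrib, mul_add]
  congr 1
  rw [Finset.sum_eq_single j (fun x _ hx => by simp [hx]) (by simp)]
  simp [Finset.sum_pi_single']

lemma sum_matsOfWeight_sub_single {k d : ℕ} (n : ℕ) (j : Fin k) (i : Fin d)
    (G : (Fin k → Fin d → ℕ) → ℝ) :
    (∑ m ∈ matsOfWeight k d n, if 0 < m j i then G (m - Pi.single j (Pi.single i 1)) else 0) =
      if j.1 + 1 ≤ n then ∑ m ∈ matsOfWeight k d (n - (j.1 + 1)), G m else 0 := by
  have hcancel : ∀ m : Fin k → Fin d → ℕ, 0 < m j i →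
      m - Pi.single j (Pi.single i 1) + Pi.single j (Pi.single i 1) = m := fun m hm => by
    refine tsub_add_cancel_of_le fun x y => ?_
    rcases eq_or_ne x j with rfl | hx
    · rcases eq_or_ne y i with rfl | hy
      · simpa using Nat.one_le_iff_ne_zero.2 hm.ne'
      · simp [hy]
    · simp [hx]
  have hweight : ∀ m : Fin k → Fin d → ℕ, 0 < m j i →
      matWeight m = matWeight (m - Pi.single j (Pi.single i 1)) + (j.1 + 1) := fun m hm => by
    rw [← matWeight_add_single, hcancel m hm]
  rw [← Finset.sum_filter]
  split_ifs with hn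
  · refine Finset.sum_nbij' (fun m => m - Pi.single j (Pi.single i 1))
      (fun m => m + Pi.single j (Pi.single i 1)) (fun m hm => ?_) (fun m hm => ?_)
      (fun m hm => ?_) (fun m hm => ?_) (fun m hm => rfl)
    · simp only [Finset.mem_filter, mem_matsOfWeight] at hm ⊢
      have := hweight m hm.2
      omega
    · simp only [Finset.mem_filter, mem_matsOfWeight] at hm ⊢
      rw [matWeight_add_single]
      exact ⟨by omega, by simp⟩
    · exact hcancel m (Finset.mem_filter.1 hm).2
    · exact add_tsub_cancel_right _ _
  · refine Finset.sum_eq_zero fun m hm => ?_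
    simp only [Finset.mem_filter, mem_matsOfWeight] at hm
    have := hweight m hm.2
    omega

/-- The coefficients of `pFrac` as a fractional power series in its `i`-th time coordinate; `B`
holds the factors contributed by the other coordinates. -/
noncomputable def pFracCoeff {k d : ℕ} (l : Fin k → ℝ) (B : Fin d → (Fin k → ℕ) → ℝ)
    (i : Fin d) (n m : ℕ) : ℝ :=
  ∑ x ∈ matsOfWeight k d n,
    (∏ i' ∈ Finset.univ.erase i, B i' (fun j => x j i')) * colCoeff l (fun j => x j i) m

lemma expBounded_pFracCoeff {k d : ℕ} (l : Fin k → ℝ) (B : Fin d → (Fin k → ℕ) → ℝ)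
    (i : Fin d) (n : ℕ) : ExpBounded (pFracCoeff l B i n) :=
  ExpBounded.sum _ fun _ _ => (expBounded_colCoeff _ _).const_mul _

lemma pFracCoeff_succ {k d : ℕ} (l : Fin k → ℝ) (B : Fin d → (Fin k → ℕ) → ℝ)
    (i : Fin d) (n m : ℕ) :
    pFracCoeff l B i n (m + 1) = -(∑ j, l j) * pFracCoeff l B i n m +
      ∑ j, l j * if j.1 + 1 ≤ n then pFracCoeff l B i (n - (j.1 + 1)) m else 0 := by
  simp only [pFracCoeff, colCoeff_succ, mul_add, Finset.sum_add_distrib]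
  congr 1
  · rw [Finset.mul_sum]
    exact Finset.sum_congr rfl fun x _ => by ring
  · simp only [Finset.mul_sum _ _ (∏ _ ∈ _, _)]
    rw [Finset.sum_comm]
    refine Finset.sum_congr rfl fun j _ => ?_
    rw [← sum_matsOfWeight_sub_single n j i (fun x =>
      (∏ i' ∈ Finset.univ.erase i, B i' (fun j => x j i')) * colCoeff l (fun j => x j i) m),
      Finset.mul_sum]
    refine Finset.sum_congr rfl fun x _ => ?_
    split_ifs with hx
    · have hcol : (fun j' => (x - Pi.single j (Pi.single i 1) : Fin k → Fin d → ℕ) j' i) =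
          (fun j' => x j' i) - Pi.single j 1 := by
        ext j'
        rcases eq_or_ne j' j with rfl | h <;> simp [*]
      have hother : ∀ i' ∈ Finset.univ.erase i,
          B i' (fun j' => (x - Pi.single j (Pi.single i 1) : Fin k → Fin d → ℕ) j' i') =
            B i' (fun j' => x j' i') := fun i' hi' => by
        congr 1
        ext j'
        rcases eq_or_ne j' j with rfl | h <;> simp [Finset.ne_of_mem_erase hi', *]
      rw [hcol, Finset.prod_congr rfl hother]
      ring
    · simp

lemma pFrac_update_eq_mlSeries {d k : ℕ} (lam : Fin k → Fin d → ℝ) (alpha : Fin d → ℝ)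
    {i : Fin d} (ha : 0 < alpha i) (n : ℕ) (t : Fin d → ℝ) {s : ℝ} (hs : 0 ≤ s) :
    pFrac d k lam alpha n (Function.update t i s) =
      mlSeries (alpha i) (pFracCoeff (fun j => lam j i)
        (fun i' v => colFactor (fun j => lam j i') (alpha i') v (t i')) i n) s := by
  rw [pFrac_eq_sum]
  unfold pFracCoeff
  rw [mlSeries_sum ha hs _ fun _ _ => (expBounded_colCoeff _ _).const_mul _]
  refine Finset.sum_congr rfl fun m _ => ?_
  rw [mlSeries_const_mul, ← colFactor_eq_mlSeries _ _ _ hs,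
    ← Finset.prod_erase_mul _ _ (Finset.mem_univ i), Function.update_self]
  congr 1
  refine Finset.prod_congr rfl fun i' hi' => ?_
  rw [Function.update_of_ne (Finset.ne_of_mem_erase hi')]

/-- For all `α ∈ (0,1)^d`, every `i`, every `n ∈ ℕ_0` and every `t ∈ ℝ_+^d` with `t_i > 0`,
the multiparameter fractional GCP distribution solves the Caputo fractional differential
equation
`(1/Γ(1−α_i)) ∫_0^{t_i} (t_i − s)^{−α_i} (∂/∂s) p_α(n, t^i(s)) ds
  = −Σ_{j=1}^k λ_{ji} (p_α(n,t) − p_α(n−j,t))`,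
where `t^i(s)` is `t` with its `i`-th coordinate replaced by `s`, and `p_α(m,t) := 0`
for `m < 0`. -/
theorem pFrac_caputo_pde (d k : ℕ) (hd : 1 ≤ d) (hk : 1 ≤ k)
    (lam : Fin k → Fin d → ℝ) (hlam : ∀ j i, 0 < lam j i)
    (alpha : Fin d → ℝ) (halpha : ∀ i, alpha i ∈ Set.Ioo (0 : ℝ) 1)
    (i : Fin d) (n : ℕ) (t : Fin d → ℝ) (ht : ∀ i', 0 ≤ t i') (hti : 0 < t i) :
    (1 / Real.Gamma (1 - alpha i)) *
      ∫ s in (0 : ℝ)..(t i), (t i - s) ^ (-(alpha i)) *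
        deriv (fun r : ℝ => pFrac d k lam alpha n (Function.update t i r)) s
    = -∑ j : Fin k, lam j i *
        (pFrac d k lam alpha n t -
          pFracZ d k lam alpha ((n : ℤ) - ((j.1 : ℤ) + 1)) t) := by
  obtain ⟨ha, -⟩ := halpha i
  set c := pFracCoeff (fun j => lam j i)
    (fun i' v => colFactor (fun j => lam j i') (alpha i') v (t i')) i with hc
  have hbdd : ∀ n, ExpBounded (c n) := fun n => expBounded_pFracCoeff _ _ _ _
  have hp : ∀ n, pFrac d k lam alpha n t = mlSeries (alpha i) (c n) (t i) := fun n => by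
    rw [hc, ← pFrac_update_eq_mlSeries lam alpha ha n t hti.le, Function.update_eq_self]
  have hderiv : ∀ s ∈ Set.Ioc 0 (t i),
      deriv (fun r : ℝ => pFrac d k lam alpha n (Function.update t i r)) s =
        deriv (mlSeries (alpha i) (c n)) s := fun s hs => by
    refine Filter.EventuallyEq.deriv_eq ?_
    filter_upwards [Ioi_mem_nhds hs.1] with r hr
    exact pFrac_update_eq_mlSeries lam alpha ha n t (le_of_lt hr)
  have hint : ∫ s in (0 : ℝ)..(t i), (t i - s) ^ (-(alpha i)) *
        deriv (fun r : ℝ => pFrac d k lam alpha n (Function.update t i r)) s =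
      ∫ s in (0 : ℝ)..(t i), (t i - s) ^ (-(alpha i)) * deriv (mlSeries (alpha i) (c n)) s := by
    rw [intervalIntegral.integral_of_le hti.le, intervalIntegral.integral_of_le hti.le]
    exact MeasureTheory.setIntegral_congr_fun measurableSet_Ioc fun s hs => by
      simp only [hderiv s hs]
  have hshift : ∀ j : Fin k,
      ExpBounded fun m => if j.1 + 1 ≤ n then c (n - (j.1 + 1)) m else 0 := fun j => by
    split_ifs
    · exact hbdd _
    · exact ⟨0, 0, le_rfl, by simp⟩
  have hpZ : ∀ j : Fin k, pFracZ d k lam alpha ((n : ℤ) - ((j.1 : ℤ) + 1)) t =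
      mlSeries (alpha i) (fun m => if j.1 + 1 ≤ n then c (n - (j.1 + 1)) m else 0) (t i) :=
    fun j => by
    rw [pFracZ]
    by_cases hj : j.1 + 1 ≤ n
    · rw [if_pos (by omega), hp, show ((n : ℤ) - ((j.1 : ℤ) + 1)).toNat = n - (j.1 + 1) by omega]
      simp only [hj, if_true]
    · rw [if_neg (by omega)]
      simp [hj, mlSeries]
  rw [hint, caputo_mlSeries (halpha i) (hbdd n) hti]
  simp only [hc, pFracCoeff_succ]
  simp only [← hc]
  rw [mlSeries_add ha hti.le ((hbdd n).const_mul _)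
      (ExpBounded.sum _ fun j _ => (hshift j).const_mul _), mlSeries_const_mul,
    mlSeries_sum ha hti.le _ fun j _ => (hshift j).const_mul _]
  simp only [mlSeries_const_mul, hpZ, hp, mul_sub, Finset.sum_sub_distrib, ← Finset.sum_mul]
  ring
end

section
/- Fix α = (α_1,…,α_d) ∈ (0,1)^d and t ∈ ℝ_+^d and let G_α(u) = ∏_{i=1}^d E_{α_i,1}(−t_i^{α_i} Σ_{j=1}^k λ_{ji}(1 − u^j)). Then for every n ≥ 1 the n-th derivative of G_α at u = 1 (the n-th factorial moment of the multiparameter fractional GCP) equals Σ_{(n_1,…,n_d) ∈ Θ(n,d)} n! ∏_{i=1}^d [ Σ_{r_i=1}^{n_i} (t_i^{r_i α_i}/Γ(r_i α_i + 1)) Σ_{n_{i1}+⋯+n_{i r_i} = n_i, n_{il} ≥ 1} ∏_{l=1}^{r_i} Σ_{j=1}^k λ_{ji} (j)_{n_{il}} / n_{il}! ], where (j)_m = j(j−1)⋯(j−m+1) is the falling factorial and the factor corresponding to an index i with n_i = 0 is taken to be 1. -/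
open scoped BigOperators

/-- The falling factorial `(j)_m = j(j−1)⋯(j−m+1)` as a real number. -/
noncomputable def fallingFact (j : ℝ) (m : ℕ) : ℝ :=
  ∏ a ∈ Finset.range m, (j - a)

open Filter Topology Polynomial

/-- A form of Gautschi's inequality: `Γ(x + a)` grows faster than `Γ(x)` for every `a > 0`. -/
theorem tendsto_Gamma_div_Gamma_add {a : ℝ} (ha : 0 < a) :
    Tendsto (fun x : ℝ => Real.Gamma x / Real.Gamma (x + a)) atTop (𝓝 0) := by
  have hlim : Tendsto (fun x : ℝ => (x - 1) ^ (-a)) atTop (𝓝 0) :=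
    (tendsto_rpow_neg_atTop ha).comp (tendsto_atTop_add_const_right _ (-1) tendsto_id)
  refine tendsto_of_tendsto_of_tendsto_of_le_of_le' tendsto_const_nhds hlim ?_ ?_
  · filter_upwards [eventually_gt_atTop 0] with x hx
    exact (div_pos (Real.Gamma_pos_of_pos hx) (Real.Gamma_pos_of_pos (by linarith))).le
  · filter_upwards [eventually_gt_atTop 1] with x hx
    have hx1 : 0 < x - 1 := by linarith
    have hG1 := Real.Gamma_pos_of_pos hx1
    have hG : 0 < Real.Gamma x := Real.Gamma_pos_of_pos (by linarith)
    have hGa : 0 < Real.Gamma (x + a) := Real.Gamma_pos_of_pos (by linarith)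
    have hrec : Real.Gamma x = (x - 1) * Real.Gamma (x - 1) := by
      simpa using Real.Gamma_add_one hx1.ne'
    have hslope := Real.convexOn_log_Gamma.slope_mono_adjacent (x := x - 1) (y := x) (z := x + a)
      hx1 (show 0 < x + a by linarith) (by linarith) (by linarith)
    have hdiff : Real.log (Real.Gamma x) - Real.log (Real.Gamma (x - 1)) = Real.log (x - 1) := by
      rw [hrec, Real.log_mul hx1.ne' hG1.ne']; ring
    simp only [Function.comp, hdiff, sub_sub_cancel, div_one, add_sub_cancel_left] at hslope
    rw [le_div_iff₀ ha] at hslope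
    rw [← Real.log_le_log_iff (div_pos hG hGa) (Real.rpow_pos_of_pos hx1 _),
      Real.log_div hG.ne' hGa.ne', Real.log_rpow hx1]
    linarith

theorem tendsto_ratio_inv_Gamma {a : ℝ} (ha : 0 < a) :
    Tendsto (fun r : ℕ => ‖(Real.Gamma ((r.succ : ℕ) * a + 1))⁻¹‖ /
      ‖(Real.Gamma ((r : ℝ) * a + 1))⁻¹‖) atTop (𝓝 0) := by
  have hlin : Tendsto (fun r : ℕ => (r : ℝ) * a + 1) atTop atTop :=
    tendsto_atTop_add_const_right _ _ (tendsto_natCast_atTop_atTop.atTop_mul_const ha)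
  refine ((tendsto_Gamma_div_Gamma_add ha).comp hlin).congr fun r => ?_
  have h1 : 0 < Real.Gamma ((r : ℝ) * a + 1) := Real.Gamma_pos_of_pos (by positivity)
  have h2 : 0 < Real.Gamma (((r.succ : ℕ) : ℝ) * a + 1) := Real.Gamma_pos_of_pos (by positivity)
  rw [Real.norm_of_nonneg (inv_pos.2 h1).le, Real.norm_of_nonneg (inv_pos.2 h2).le,
    Function.comp_apply, show (r : ℝ) * a + 1 + a = ((r.succ : ℕ) : ℝ) * a + 1 by push_cast; ring]
  field_simp

theorem Polynomial.contDiffAt_eval (p : ℝ[X]) (N : ℕ) (x : ℝ) :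
    ContDiffAt ℝ N (fun h => p.eval h) x := by
  simpa using (p.contDiff_aeval (𝕜 := ℝ) N).contDiffAt

/-- Local expansion to order `N` at the origin: `f` is the polynomial `p` up to a smooth multiple
of `h ^ (N + 1)`. -/
def HasSmoothRemainder (N : ℕ) (f : ℝ → ℝ) (p : ℝ[X]) : Prop :=
  ∃ g : ℝ → ℝ, ContDiffAt ℝ N g 0 ∧ ∀ h, f h = p.eval h + h ^ (N + 1) * g h

theorem HasSmoothRemainder.mul {N : ℕ} {f₁ f₂ : ℝ → ℝ} {p₁ p₂ : ℝ[X]}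
    (h₁ : HasSmoothRemainder N f₁ p₁) (h₂ : HasSmoothRemainder N f₂ p₂) :
    HasSmoothRemainder N (fun h => f₁ h * f₂ h) (p₁ * p₂) := by
  obtain ⟨g₁, hg₁, e₁⟩ := h₁
  obtain ⟨g₂, hg₂, e₂⟩ := h₂
  have hp₁ : ContDiffAt ℝ N (fun h => p₁.eval h) 0 := p₁.contDiffAt_eval N 0
  have hp₂ : ContDiffAt ℝ N (fun h => p₂.eval h) 0 := p₂.contDiffAt_eval N 0
  refine ⟨fun h => p₁.eval h * g₂ h + g₁ h * p₂.eval h + h ^ (N + 1) * (g₁ h * g₂ h), ?_, ?_⟩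
  · fun_prop
  · intro h
    simp only [e₁, e₂, eval_mul]
    ring

theorem HasSmoothRemainder.prod {ι : Type*} {N : ℕ} {f : ι → ℝ → ℝ} {p : ι → ℝ[X]}
    (s : Finset ι) (hf : ∀ i ∈ s, HasSmoothRemainder N (f i) (p i)) :
    HasSmoothRemainder N (fun h => ∏ i ∈ s, f i h) (∏ i ∈ s, p i) := by
  classical
  induction s using Finset.induction_on with
  | empty => exact ⟨fun _ => 0, contDiffAt_const, by simp⟩
  | insert i s hi ih =>
    simp only [Finset.prod_insert hi]
    exact (hf i (Finset.mem_insert_self i s)).mul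
      (ih fun j hj => hf j (Finset.mem_insert_of_mem hj))

theorem Polynomial.iteratedDeriv_eval_zero (p : ℝ[X]) (n : ℕ) :
    iteratedDeriv n (fun h => p.eval h) 0 = n.factorial * p.coeff n := by
  have key : ∀ m : ℕ, iteratedDeriv m (fun h => p.eval h) =
      fun h => (derivative^[m] p).eval h := by
    intro m
    induction m with
    | zero => simp
    | succ m ih =>
      rw [iteratedDeriv_succ, ih]
      funext h
      rw [Polynomial.deriv, Function.iterate_succ_apply']
  rw [key]
  simp only
  rw [← coeff_zero_eq_eval_zero, coeff_iterate_derivative]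
  simp [Nat.descFactorial_self]

theorem HasSmoothRemainder.iteratedDeriv_eq {N : ℕ} {f : ℝ → ℝ} {p : ℝ[X]}
    (hf : HasSmoothRemainder N f p) : iteratedDeriv N f 0 = N.factorial * p.coeff N := by
  obtain ⟨g, hg, e⟩ := hf
  have hp : ContDiffAt ℝ N (fun h => p.eval h) 0 := p.contDiffAt_eval N 0
  have hm : ContDiffAt ℝ N (fun h : ℝ => h ^ (N + 1)) 0 := by fun_prop
  rw [show f = fun h => p.eval h + h ^ (N + 1) * g h from funext e,
    iteratedDeriv_fun_add hp (hm.mul hg), p.iteratedDeriv_eval_zero, iteratedDeriv_fun_mul hm hg,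
    Finset.sum_eq_zero, add_zero]
  intro i hi
  rw [iteratedDeriv_fun_pow_zero, if_neg (by have := Finset.mem_range.1 hi; lia)]
  simp

/-- Substituting a polynomial without constant term into an entire power series. -/
theorem hasSmoothRemainder_tsum_eval {a : ℕ → ℝ} (ha : ∀ r, a r ≠ 0)
    (hratio : Tendsto (fun r => ‖a r.succ‖ / ‖a r‖) atTop (𝓝 0)) {P : ℝ[X]} (hP : P.coeff 0 = 0)
    (N : ℕ) :
    HasSmoothRemainder N (fun h => ∑' r, a r * P.eval h ^ r)
      (∑ r ∈ Finset.range (N + 1), C (a r) * P ^ r) := by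
  obtain ⟨S, rfl⟩ := X_dvd_iff.2 hP
  set b : ℕ → ℝ := fun r => a (r + (N + 1)) with hb
  have hrad := FormalMultilinearSeries.ofScalars_radius_eq_top_of_tendsto ℝ a
    (Eventually.of_forall ha) hratio
  have hradb := FormalMultilinearSeries.ofScalars_radius_eq_top_of_tendsto ℝ b
    (Eventually.of_forall fun r => ha _) (by
      refine (hratio.comp (tendsto_add_atTop_nat (N + 1))).congr fun r => ?_
      simp only [Function.comp, hb, Nat.succ_eq_add_one]
      rw [show r + (N + 1) + 1 = r + 1 + (N + 1) by ring])
  have hsum : ∀ x : ℝ, Summable fun r => a r * x ^ r := by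
    intro x
    have := (FormalMultilinearSeries.ofScalars ℝ a).summable (x := x) (by simp [hrad])
    simpa only [FormalMultilinearSeries.ofScalars_apply_eq, smul_eq_mul] using this
  have hR : ContDiffAt ℝ N (fun x : ℝ => ∑' r, b r * x ^ r) 0 := by
    have h1 := (FormalMultilinearSeries.ofScalars ℝ b).hasFPowerSeriesOnBall (by simp [hradb])
    have h2 : ContDiffAt ℝ N (FormalMultilinearSeries.ofScalars ℝ b).sum 0 :=
      h1.analyticAt.contDiffAt
    have h3 : (FormalMultilinearSeries.ofScalars ℝ b).sum = fun x : ℝ => ∑' r, b r * x ^ r := by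
      exact FormalMultilinearSeries.ofScalarsSum_eq_tsum (E := ℝ) b
    rwa [h3] at h2
  refine ⟨fun h => S.eval h ^ (N + 1) * ∑' r, b r * (X * S).eval h ^ r, ?_, ?_⟩
  · have hS : ContDiffAt ℝ N (fun h => S.eval h) 0 := S.contDiffAt_eval N 0
    have hQ : ContDiffAt ℝ N (fun h => (X * S).eval h) 0 := (X * S).contDiffAt_eval N 0
    refine (hS.pow _).mul (ContDiffAt.comp (g := fun x : ℝ => ∑' r, b r * x ^ r) 0 ?_ hQ)
    simpa using hR
  · intro h
    simp only
    rw [← (hsum _).sum_add_tsum_nat_add (N + 1), eval_finsetSum]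
    congr 1
    · simp
    · rw [← mul_assoc, ← mul_pow, ← tsum_mul_left]
      refine tsum_congr fun r => ?_
      simp only [hb, eval_mul, eval_X]
      ring

theorem Polynomial.coeff_prod_univ_eq_tsum {ι : Type*} [Fintype ι] (p : ι → ℝ[X]) (n : ℕ) :
    (∏ i, p i).coeff n =
      ∑' m : ι → ℕ, if (∑ i, m i) = n then ∏ i, (p i).coeff (m i) else 0 := by
  classical
  have hcoe : ((∏ i, p i : ℝ[X]) : PowerSeries ℝ) = ∏ i, (p i : PowerSeries ℝ) := by
    exact map_prod (coeToPowerSeries.ringHom (R := ℝ)) p Finset.univ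
  rw [← coeff_coe, hcoe, PowerSeries.coeff_prod,
    tsum_eq_sum (s := Finset.piAntidiag Finset.univ n)]
  · refine Finset.sum_bij (fun l _ => ⇑l) ?_ ?_ ?_ ?_
    · intro l hl
      simpa using (Finset.mem_finsuppAntidiag.1 hl).1
    · intro l _ l' _ h
      exact DFunLike.coe_injective h
    · intro m hm
      refine ⟨Finsupp.equivFunOnFinite.symm m, ?_, by simp⟩
      simpa using hm
    · intro l hl
      rw [if_pos (Finset.mem_finsuppAntidiag.1 hl).1]
      simp
  · intro m hm
    exact if_neg (by simpa using hm)

theorem natCast_choose_eq_fallingFact_div (j m : ℕ) :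
    (j.choose m : ℝ) = fallingFact j m / m.factorial := by
  rw [Nat.cast_choose_eq_descPochhammer_div, descPochhammer_eval_eq_prod_range, fallingFact]

/-- The polynomial `∑ⱼ cⱼ ((1 + X) ^ (j + 1) - 1)`. -/
noncomputable def jumpPoly {k : ℕ} (c : Fin k → ℝ) : ℝ[X] :=
  ∑ j : Fin k, C (c j) * ((1 + X) ^ (j.1 + 1) - 1)

theorem eval_jumpPoly {k : ℕ} (c : Fin k → ℝ) (h : ℝ) :
    (jumpPoly c).eval h = -∑ j : Fin k, c j * (1 - (1 + h) ^ (j.1 + 1)) := by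
  rw [jumpPoly, eval_finsetSum, ← Finset.sum_neg_distrib]
  refine Finset.sum_congr rfl fun j _ => ?_
  simp
  ring

theorem coeff_jumpPoly_zero {k : ℕ} (c : Fin k → ℝ) : (jumpPoly c).coeff 0 = 0 := by
  simp [coeff_zero_eq_eval_zero, eval_jumpPoly]

theorem coeff_jumpPoly {k : ℕ} (c : Fin k → ℝ) {m : ℕ} (hm : 1 ≤ m) :
    (jumpPoly c).coeff m =
      ∑ j : Fin k, c j * fallingFact ((j.1 : ℝ) + 1) m / m.factorial := by
  rw [jumpPoly, finsetSum_coeff]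
  refine Finset.sum_congr rfl fun j _ => ?_
  rw [coeff_C_mul, coeff_sub, coeff_one_add_X_pow, coeff_one, if_neg (by lia),
    natCast_choose_eq_fallingFact_div]
  push_cast
  ring

theorem coeff_jumpPoly_pow {k : ℕ} (c : Fin k → ℝ) (r m : ℕ) :
    (jumpPoly c ^ r).coeff m =
      ∑' e : Fin r → ℕ, if (∀ l, 1 ≤ e l) ∧ (∑ l, e l) = m then
        ∏ l, ∑ j : Fin k, c j * fallingFact ((j.1 : ℝ) + 1) (e l) / (Nat.factorial (e l))
      else 0 := by
  have hpow : jumpPoly c ^ r = ∏ _l : Fin r, jumpPoly c := by simp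
  rw [hpow, coeff_prod_univ_eq_tsum]
  refine tsum_congr fun e => ?_
  by_cases he : ∀ l, 1 ≤ e l
  · simp only [he, implies_true, true_and]
    congr 1
    exact Finset.prod_congr rfl fun l _ => coeff_jumpPoly c (he l)
  · obtain ⟨l, hl⟩ := not_forall.1 he
    have hzero : ∏ l, (jumpPoly c).coeff (e l) = 0 :=
      Finset.prod_eq_zero (Finset.mem_univ l) (by
        rw [Nat.lt_one_iff.1 (not_le.1 hl), coeff_jumpPoly_zero])
    simp only [he, false_and, if_false, hzero, ite_self]

theorem coeff_jumpPoly_pow_of_lt {k : ℕ} (c : Fin k → ℝ) {r m : ℕ} (h : m < r) :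
    (jumpPoly c ^ r).coeff m = 0 :=
  X_pow_dvd_iff.1 (pow_dvd_pow_of_dvd (X_dvd_iff.2 (coeff_jumpPoly_zero c)) r) m h

theorem ml3_one_one (a x : ℝ) :
    ml3 a 1 1 x = ∑' r : ℕ, (Real.Gamma ((r : ℝ) * a + 1))⁻¹ * x ^ r := by
  refine tsum_congr fun r => ?_
  have : (r.factorial : ℝ) ≠ 0 := by positivity
  rw [Real.Gamma_nat_eq_factorial, Real.Gamma_one]
  field_simp

/-- Fix `α ∈ (0,1)^d` and `t ∈ ℝ_+^d` and let
`G_α(u) = ∏_{i=1}^d E_{α_i,1}(−t_i^{α_i} Σ_{j=1}^k λ_{ji}(1 − u^j))` be the pgf of the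
multiparameter fractional GCP. Then for every `n ≥ 1` the `n`-th derivative of `G_α` at
`u = 1` (its `n`-th factorial moment) equals
`Σ_{(n_1,…,n_d) ∈ Θ(n,d)} n! ∏_i [ Σ_{r_i=1}^{n_i} (t_i^{r_i α_i}/Γ(r_i α_i + 1))
  Σ_{n_{i1}+⋯+n_{i r_i} = n_i, n_{il} ≥ 1} ∏_{l=1}^{r_i} Σ_{j=1}^k λ_{ji} (j)_{n_{il}}/n_{il}! ]`,
where the factor corresponding to an index `i` with `n_i = 0` is taken to be `1`. -/
theorem pFrac_factorial_moment (d k : ℕ) (hd : 1 ≤ d) (hk : 1 ≤ k)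
    (lam : Fin k → Fin d → ℝ) (hlam : ∀ j i, 0 < lam j i)
    (alpha : Fin d → ℝ) (halpha : ∀ i, alpha i ∈ Set.Ioo (0 : ℝ) 1)
    (t : Fin d → ℝ) (ht : ∀ i, 0 ≤ t i) (n : ℕ) (hn : 1 ≤ n) :
    iteratedDeriv n
      (fun u : ℝ => ∏ i,
        ml3 (alpha i) 1 1 (-(t i ^ alpha i) * ∑ j : Fin k, lam j i * (1 - u ^ (j.1 + 1)))) 1
    = ∑' m : Fin d → ℕ,
        if (∑ i, m i) = n then
          (Nat.factorial n : ℝ) *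
            ∏ i,
              (if m i = 0 then (1 : ℝ) else
                ∑ r ∈ Finset.Icc 1 (m i),
                  (t i ^ ((r : ℝ) * alpha i) / Real.Gamma (r * alpha i + 1)) *
                    ∑' c : Fin r → ℕ,
                      if (∀ l, 1 ≤ c l) ∧ (∑ l, c l) = m i then
                        ∏ l, ∑ j : Fin k,
                          lam j i * fallingFact ((j.1 : ℝ) + 1) (c l) /
                            (Nat.factorial (c l))
                      else 0)
        else 0 := by
  classical
  have hGamma : ∀ (i : Fin d) (r : ℕ), (Real.Gamma ((r : ℝ) * alpha i + 1))⁻¹ ≠ 0 := fun i r =>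
    inv_ne_zero (Real.Gamma_pos_of_pos (by have := (halpha i).1; positivity)).ne'
  set P : Fin d → ℝ[X] := fun i => C (t i ^ alpha i) * jumpPoly fun j => lam j i with hPdef
  have hP0 : ∀ i, (P i).coeff 0 = 0 := fun i => by simp [hPdef, coeff_jumpPoly_zero]
  have hexp := HasSmoothRemainder.prod Finset.univ fun i _ =>
    hasSmoothRemainder_tsum_eval (hGamma i) (tendsto_ratio_inv_Gamma (halpha i).1) (hP0 i) n
  have hshift := congrFun (iteratedDeriv_comp_const_add n (fun u : ℝ => ∏ i,
    ml3 (alpha i) 1 1 (-(t i ^ alpha i) * ∑ j : Fin k, lam j i * (1 - u ^ (j.1 + 1)))) 1) 0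
  rw [add_zero] at hshift
  rw [← hshift]
  have hfun : (fun h : ℝ => ∏ i, ml3 (alpha i) 1 1
      (-(t i ^ alpha i) * ∑ j : Fin k, lam j i * (1 - (1 + h) ^ (j.1 + 1)))) =
      fun h => ∏ i, ∑' r : ℕ, (Real.Gamma ((r : ℝ) * alpha i + 1))⁻¹ * (P i).eval h ^ r := by
    funext h
    refine Finset.prod_congr rfl fun i _ => ?_
    rw [ml3_one_one]
    simp [hPdef, eval_jumpPoly]
  rw [hfun, hexp.iteratedDeriv_eq, coeff_prod_univ_eq_tsum, ← tsum_mul_left]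
  refine tsum_congr fun m => ?_
  split_ifs with hm
  swap
  · rw [mul_zero]
  congr 1
  refine Finset.prod_congr rfl fun i _ => ?_
  have hmi : m i ≤ n := hm ▸ Finset.single_le_sum (fun _ _ => Nat.zero_le _) (Finset.mem_univ i)
  have hterm : ∀ r : ℕ, (C (Real.Gamma ((r : ℝ) * alpha i + 1))⁻¹ * P i ^ r).coeff (m i) =
      t i ^ ((r : ℝ) * alpha i) / Real.Gamma (r * alpha i + 1) *
        ((jumpPoly fun j => lam j i) ^ r).coeff (m i) := fun r => by
    rw [hPdef, mul_pow, ← C_pow, coeff_C_mul, coeff_C_mul, mul_comm (r : ℝ),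
      Real.rpow_mul_natCast (ht i)]
    ring
  rw [finsetSum_coeff, Finset.sum_congr rfl fun r _ => hterm r]
  have hvanish : ∀ r : ℕ, m i < r → t i ^ ((r : ℝ) * alpha i) / Real.Gamma (r * alpha i + 1) *
      ((jumpPoly fun j => lam j i) ^ r).coeff (m i) = 0 := fun r hr => by
    rw [coeff_jumpPoly_pow_of_lt _ hr, mul_zero]
  split_ifs with h0
  · rw [Finset.sum_eq_single 0 (fun r _ hr => hvanish r (by lia)) (by simp)]
    simp [h0]
  · simp only [← coeff_jumpPoly_pow]
    symm
    refine Finset.sum_subset (fun r hr => ?_) fun r _ hr => ?_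
    · simp only [Finset.mem_Icc, Finset.mem_range] at hr ⊢; lia
    · rcases Nat.eq_zero_or_pos r with rfl | hpos
      · simp [coeff_one, h0]
      · exact hvanish r (by simp only [Finset.mem_Icc] at hr; lia)
end
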